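/- arXiv:1201.0738 — 4 statements merged into one kernel-verified Lean document; each statement's English description precedes it below -/
import Mathlib

section
/- Given complex numbers λ_1, ..., λ_n, all with negative real part, whose multiset is closed under complex conjugation, there exists a unique Schwarz matrix J_n with all parameters b_0, ..., b_{n-1} positive whose spectrum (with multiplicity) is {λ_1, ..., λ_n}. -/
open Polynomial Matrix

/-- The Schwarz matrix `J_n` with parameters `b 0, …, b (n-1)`:
`J(1,1) = -b₀` (1-based), superdiagonal `1`, subdiagonal `-b₁, …, -b_{n-1}`. -/
def schwarzMatrix {n : ℕ} (b : Fin n → ℝ) : Matrix (Fin n) (Fin n) ℝ :=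
  Matrix.of fun i j : Fin n =>
    if (i : ℕ) = 0 ∧ (j : ℕ) = 0 then -b i
    else if (i : ℕ) + 1 = (j : ℕ) then 1
    else if (i : ℕ) = (j : ℕ) + 1 then -b i
    else 0

/-- The multiset of complex roots of a real polynomial. -/
noncomputable def cRoots (p : Polynomial ℝ) : Multiset ℂ :=
  (p.map (algebraMap ℝ ℂ)).roots

theorem Matrix.det_succ_succ_of_tridiagonal_corner {R : Type*} [CommRing R] {n : ℕ}
    (A : Matrix (Fin (n + 2)) (Fin (n + 2)) R)
    (hrow : ∀ j : Fin n, A 0 j.succ.succ = 0) (hcol : ∀ i : Fin n, A i.succ.succ 0 = 0) :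
    A.det = A 0 0 * (A.submatrix Fin.succ Fin.succ).det -
      A 0 1 * A 1 0 *
        (A.submatrix (fun i : Fin n => i.succ.succ) (fun i : Fin n => i.succ.succ)).det := by
  have hminor : (A.submatrix Fin.succ (Fin.succAbove 1)).det = A 1 0 *
      (A.submatrix (fun i : Fin n => i.succ.succ) (fun i : Fin n => i.succ.succ)).det := by
    rw [det_succ_column_zero, Fin.sum_univ_succ]
    simp [hcol, submatrix_submatrix]
    rfl
  rw [det_succ_row_zero, Fin.sum_univ_succ, Fin.sum_univ_succ]
  simp [hrow, hminor]
  ring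

/-- Replace the first entry of a finite sequence by `0`. -/
def zeroHead {n : ℕ} (b : Fin n → ℝ) : Fin n → ℝ := fun i => if (i : ℕ) = 0 then 0 else b i

theorem schwarzMatrix_charpoly_succ_succ {n : ℕ} (b : Fin (n + 2) → ℝ) :
    (schwarzMatrix b).charpoly =
      (X + C (b 0)) * (schwarzMatrix (zeroHead (Fin.tail b))).charpoly +
        C (b 1) * (schwarzMatrix (zeroHead (Fin.tail (Fin.tail b)))).charpoly := by
  have h1 : (schwarzMatrix b).charmatrix.submatrix Fin.succ Fin.succ =
      (schwarzMatrix (zeroHead (Fin.tail b))).charmatrix := by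
    ext1 i j
    simp only [submatrix_apply, charmatrix_apply, diagonal_apply, schwarzMatrix, of_apply,
      zeroHead, Fin.tail, Fin.val_succ, Fin.succ_inj]
    grind
  have h2 : (schwarzMatrix b).charmatrix.submatrix (fun i : Fin n => i.succ.succ)
      (fun i : Fin n => i.succ.succ) =
      (schwarzMatrix (zeroHead (Fin.tail (Fin.tail b)))).charmatrix := by
    ext1 i j
    simp only [submatrix_apply, charmatrix_apply, diagonal_apply, schwarzMatrix, of_apply,
      zeroHead, Fin.tail, Fin.val_succ, Fin.succ_inj]
    grind
  rw [charpoly, det_succ_succ_of_tridiagonal_corner, h1, h2, ← charpoly, ← charpoly]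
  · simp [schwarzMatrix]
  · intro j
    rw [charmatrix_apply_ne _ _ _ (Fin.succ_ne_zero _).symm]
    simp [schwarzMatrix]
  · intro i
    rw [charmatrix_apply_ne _ _ _ (Fin.succ_ne_zero _)]
    simp [schwarzMatrix]

theorem schwarzMatrix_charpoly_zeroHead_succ_succ {n : ℕ} (b : Fin (n + 2) → ℝ) :
    (schwarzMatrix (zeroHead b)).charpoly =
      X * (schwarzMatrix (zeroHead (Fin.tail b))).charpoly +
        C (b 1) * (schwarzMatrix (zeroHead (Fin.tail (Fin.tail b)))).charpoly := by
  have h1 : zeroHead (Fin.tail (zeroHead b)) = zeroHead (Fin.tail b) := by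
    ext i; simp [zeroHead, Fin.tail]
  have h2 : Fin.tail (Fin.tail (zeroHead b)) = Fin.tail (Fin.tail b) := by
    ext i; simp [zeroHead, Fin.tail]
  rw [schwarzMatrix_charpoly_succ_succ, h1, h2]
  simp [zeroHead]

theorem schwarzMatrix_charpoly_one (b : Fin 1 → ℝ) :
    (schwarzMatrix b).charpoly = X + C (b 0) := by
  simp [charpoly, schwarzMatrix]

theorem schwarzMatrix_charpoly_succ {n : ℕ} (b : Fin (n + 1) → ℝ) :
    (schwarzMatrix b).charpoly = (schwarzMatrix (zeroHead b)).charpoly +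
      C (b 0) * (schwarzMatrix (zeroHead (Fin.tail b))).charpoly := by
  cases n with
  | zero => simp [schwarzMatrix_charpoly_one, zeroHead]
  | succ n =>
    rw [schwarzMatrix_charpoly_succ_succ, schwarzMatrix_charpoly_zeroHead_succ_succ]
    ring

/-- The characteristic polynomial of a Schwarz matrix with zero corner has the parity of its degree. -/
theorem schwarzMatrix_charpoly_zeroHead_comp_neg_X {n : ℕ} (b : Fin n → ℝ) :
    (schwarzMatrix (zeroHead b)).charpoly.comp (-X) =
      (-1) ^ n * (schwarzMatrix (zeroHead b)).charpoly := by
  induction n using Nat.twoStepInduction with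
  | zero => simp
  | one => simp [schwarzMatrix_charpoly_one, zeroHead]
  | more n ih ih' =>
    rw [schwarzMatrix_charpoly_zeroHead_succ_succ]
    simp only [add_comp, mul_comp, X_comp, C_comp, ih, ih']
    ring

theorem schwarzMatrix_charpoly_comp_neg_X {n : ℕ} (b : Fin n → ℝ) :
    (schwarzMatrix b).charpoly.comp (-X) =
      (-1) ^ n * (2 * (schwarzMatrix (zeroHead b)).charpoly - (schwarzMatrix b).charpoly) := by
  cases n with
  | zero => simp; norm_num
  | succ n =>
    rw [schwarzMatrix_charpoly_succ]
    simp only [add_comp, mul_comp, C_comp, schwarzMatrix_charpoly_zeroHead_comp_neg_X]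
    ring

theorem schwarzMatrix_charpoly_eq_tail {n : ℕ} (b : Fin (n + 1) → ℝ) :
    (schwarzMatrix b).charpoly =
      (X + C (b 0) - 1) * (schwarzMatrix (zeroHead (Fin.tail b))).charpoly +
        (schwarzMatrix (Fin.tail b)).charpoly := by
  cases n with
  | zero => simp [schwarzMatrix_charpoly_one]
  | succ n =>
    rw [schwarzMatrix_charpoly_succ_succ, schwarzMatrix_charpoly_succ (Fin.tail b)]
    simp only [Fin.tail, Fin.succ_zero_eq_one]
    ring

theorem schwarzMatrix_charpoly_injOn {n : ℕ} :
    Set.InjOn (fun b : Fin n → ℝ => (schwarzMatrix b).charpoly) {b | ∀ i, 0 < b i} := by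
  induction n with
  | zero => exact fun _ _ _ _ _ => Subsingleton.elim _ _
  | succ n ih =>
    intro b hb b' hb' h
    dsimp only at h
    have hQ : (schwarzMatrix (zeroHead b)).charpoly = (schwarzMatrix (zeroHead b')).charpoly := by
      have e := congrArg (fun p => (-1) ^ (n + 1) * p.comp (-X)) h
      simp only [schwarzMatrix_charpoly_comp_neg_X, ← mul_assoc, ← mul_pow] at e
      simp only [h, mul_neg, mul_one, neg_neg, one_pow, one_mul, sub_left_inj] at e
      exact mul_left_cancel₀ two_ne_zero e
    have hR : C (b 0) * (schwarzMatrix (zeroHead (Fin.tail b))).charpoly =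
        C (b' 0) * (schwarzMatrix (zeroHead (Fin.tail b'))).charpoly := by
      rw [schwarzMatrix_charpoly_succ, schwarzMatrix_charpoly_succ b', hQ] at h
      exact add_left_cancel h
    have h0 : b 0 = b' 0 := by
      simpa [(charpoly_monic _).leadingCoeff] using congrArg leadingCoeff hR
    have hT : (schwarzMatrix (zeroHead (Fin.tail b))).charpoly =
        (schwarzMatrix (zeroHead (Fin.tail b'))).charpoly := by
      rw [h0] at hR
      exact mul_left_cancel₀ (C_ne_zero.2 (hb' 0).ne') hR
    rw [schwarzMatrix_charpoly_eq_tail, schwarzMatrix_charpoly_eq_tail b', h0, hT] at h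
    have ht : Fin.tail b = Fin.tail b' :=
      ih (fun i => hb i.succ) (fun i => hb' i.succ) (add_left_cancel h)
    rw [← Fin.cons_self_tail b, ← Fin.cons_self_tail b', h0, ht]

theorem norm_sub_sq_eq_norm_add_conj_sq (z w : ℂ) :
    ‖z - w‖ ^ 2 = ‖z + starRingEnd ℂ w‖ ^ 2 + 4 * (-w.re) * z.re := by
  rw [Complex.sq_norm, Complex.sq_norm, Complex.normSq_apply, Complex.normSq_apply]
  simp
  ring

theorem norm_prod_add_conj_le (Λ : Multiset ℂ) (hre : ∀ w ∈ Λ, w.re < 0) {z : ℂ}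
    (hz : 0 ≤ z.re) :
    ‖(Λ.map fun w => z + starRingEnd ℂ w).prod‖ ≤ ‖(Λ.map fun w => z - w).prod‖ := by
  induction Λ using Multiset.induction with
  | empty => simp
  | cons w s ih =>
    simp only [Multiset.mem_cons, forall_eq_or_imp] at hre
    simp only [Multiset.map_cons, Multiset.prod_cons, norm_mul]
    refine mul_le_mul ((sq_le_sq₀ (norm_nonneg _) (norm_nonneg _)).1 ?_) (ih hre.2)
      (norm_nonneg _) (norm_nonneg _)
    rw [norm_sub_sq_eq_norm_add_conj_sq]
    nlinarith [mul_nonneg (neg_pos.2 hre.1).le hz]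

theorem sum_re_nonpos (Λ : Multiset ℂ) (hre : ∀ w ∈ Λ, w.re < 0) : Λ.sum.re ≤ 0 := by
  induction Λ using Multiset.induction with
  | empty => simp
  | cons w s ih =>
    simp only [Multiset.mem_cons, forall_eq_or_imp] at hre
    simpa using add_nonpos hre.1.le (ih hre.2)

/-- A Julia–Carathéodory type inequality for finite Blaschke products of the half-plane, cleared
of denominators. -/
theorem re_mul_sq_norm_prod_sub_le (Λ : Multiset ℂ) (hre : ∀ w ∈ Λ, w.re < 0) {z : ℂ}
    (hz : 0 ≤ z.re) :
    z.re * ‖(Λ.map fun w => z - w).prod - (Λ.map fun w => z + starRingEnd ℂ w).prod‖ ^ 2 ≤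
      -Λ.sum.re * (‖(Λ.map fun w => z - w).prod‖ ^ 2 -
        ‖(Λ.map fun w => z + starRingEnd ℂ w).prod‖ ^ 2) := by
  induction Λ using Multiset.induction with
  | empty => simp
  | cons w s ih =>
    have hw : w.re < 0 := hre w (Multiset.mem_cons_self w s)
    have hs : ∀ v ∈ s, v.re < 0 := fun v hv => hre v (Multiset.mem_cons_of_mem hv)
    have hsum : s.sum.re ≤ 0 := sum_re_nonpos s hs
    specialize ih hs
    simp only [Multiset.map_cons, Multiset.prod_cons, Multiset.sum_cons, Complex.add_re]
    have hQP : ‖(s.map fun w => z + starRingEnd ℂ w).prod‖ ^ 2 ≤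
        ‖(s.map fun w => z - w).prod‖ ^ 2 :=
      pow_le_pow_left₀ (norm_nonneg _) (norm_prod_add_conj_le s hs hz) 2
    generalize (s.map fun w => z - w).prod = p at ih hQP ⊢
    generalize (s.map fun w => z + starRingEnd ℂ w).prod = q at ih hQP ⊢
    generalize s.sum.re = σ at ih hsum ⊢
    have key : ‖(z - w) * p - (z + starRingEnd ℂ w) * q‖ ≤
        -2 * w.re * ‖p‖ + ‖z + starRingEnd ℂ w‖ * ‖p - q‖ := by
      have e : (z - w) * p - (z + starRingEnd ℂ w) * q =
          ((-2 * w.re : ℝ) : ℂ) * p + (z + starRingEnd ℂ w) * (p - q) := by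
        have := Complex.add_conj w
        push_cast at this ⊢
        linear_combination (-p) * this
      rw [e]
      refine (norm_add_le _ _).trans ?_
      rw [norm_mul, norm_mul, Complex.norm_real, Real.norm_of_nonneg (by linarith)]
    rw [norm_mul (z - w), norm_mul (z + _) q, mul_pow, mul_pow,
      norm_sub_sq_eq_norm_add_conj_sq z w]
    have key2 := mul_le_mul_of_nonneg_left (pow_le_pow_left₀ (norm_nonneg _) key 2) hz
    refine key2.trans ?_
    generalize ‖z + starRingEnd ℂ w‖ = u
    generalize ‖p - q‖ = d at ih
    generalize ‖p‖ = P at ih hQP ⊢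
    generalize ‖q‖ = Q at ih hQP ⊢
    generalize z.re = x at ih hz ⊢
    have h1 := mul_le_mul_of_nonneg_left ih (sq_nonneg u)
    have h2 : 4 * x * P * u * d ≤ 4 * -σ * x * P ^ 2 + u ^ 2 * (P ^ 2 - Q ^ 2) := by
      rcases hsum.lt_or_eq with hσ | rfl
      · refine le_of_mul_le_mul_left ?_ (neg_pos.2 hσ)
        nlinarith [mul_nonneg hz (sq_nonneg (2 * σ * P + u * d))]
      · have hx : x * d = 0 := by
          have : x * d ^ 2 = 0 := le_antisymm (by simpa using ih) (by positivity)
          simpa using this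
        have h3 := mul_nonneg (sq_nonneg u) (sub_nonneg.2 hQP)
        linear_combination h3 + 4 * P * u * hx
    have h4 := mul_le_mul_of_nonneg_left h2 (neg_pos.2 hw).le
    linear_combination h1 + h4

theorem sum_re_neg (Λ : Multiset ℂ) (hre : ∀ w ∈ Λ, w.re < 0) (h0 : Λ ≠ 0) : Λ.sum.re < 0 := by
  obtain ⟨w, hw⟩ := Multiset.exists_mem_of_ne_zero h0
  obtain ⟨s, rfl⟩ := Multiset.exists_cons_of_mem hw
  simp only [Multiset.mem_cons, forall_eq_or_imp] at hre
  simpa using add_neg_of_neg_of_nonpos hre.1 (sum_re_nonpos s hre.2)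

theorem Polynomial.Monic.map_eq_prod_cRoots {p : ℝ[X]} (hp : p.Monic) :
    p.map (algebraMap ℝ ℂ) = ((cRoots p).map fun w => X - C w).prod :=
  (IsAlgClosed.splits _).eq_prod_roots_of_monic (hp.map _)

theorem Polynomial.Monic.aeval_eq_prod_cRoots {p : ℝ[X]} (hp : p.Monic) (z : ℂ) :
    aeval z p = ((cRoots p).map fun w => z - w).prod := by
  rw [← eval_map_algebraMap, hp.map_eq_prod_cRoots, eval_multiset_prod, Multiset.map_map]
  simp

theorem card_cRoots (p : ℝ[X]) : (cRoots p).card = p.natDegree := by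
  rw [cRoots, ← (IsAlgClosed.splits _).natDegree_eq_card_roots, natDegree_map]

theorem Polynomial.Monic.neg_one_pow_mul_aeval_neg {p : ℝ[X]} (hp : p.Monic) (z : ℂ) :
    (-1) ^ p.natDegree * aeval (-z) p =
      ((cRoots p).map fun w => z + starRingEnd ℂ w).prod := by
  have h : aeval (-z) p = starRingEnd ℂ (aeval (-starRingEnd ℂ z) p) := by
    rw [← aeval_conj]; simp
  rw [h, hp.aeval_eq_prod_cRoots, map_multiset_prod, Multiset.map_map, ← card_cRoots]
  have hconst : (-1 : ℂ) ^ (cRoots p).card = ((cRoots p).map fun _ => (-1 : ℂ)).prod := by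
    simp
  rw [hconst, ← Multiset.prod_map_mul]
  congr 1
  refine Multiset.map_congr rfl fun w _ => ?_
  simp
  ring

theorem Polynomial.Monic.sum_cRoots {p : ℝ[X]} (hp : p.Monic) :
    (cRoots p).sum = -(p.nextCoeff : ℂ) := by
  have h := nextCoeff_map (algebraMap ℝ ℂ).injective p
  rw [hp.map_eq_prod_cRoots, multiset_prod_X_sub_C_nextCoeff] at h
  rw [← neg_eq_iff_eq_neg, h]
  rfl

theorem Polynomial.coeff_comp_neg_X {R : Type*} [CommRing R] (p : R[X]) (k : ℕ) :
    (p.comp (-X)).coeff k = (-1) ^ k * p.coeff k := by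
  rw [show (-X : R[X]) = C (-1) * X by simp, comp_C_mul_X_coeff, mul_comm]

/-- The Routh reduction of a real polynomial of degree `n + 1`: writing `p = A + B` with `A` of the
parity of `n + 1` and `B` of the parity of `n`, it is `A + (1 - X) * B / b`, with `b` the leading
coefficient of `B`. -/
noncomputable def routhReduction (n : ℕ) (p : ℝ[X]) : ℝ[X] :=
  C (1 / 2) * (p + (-1) ^ (n + 1) * p.comp (-X)) +
    (1 - X) * (C (1 / (2 * p.coeff n)) * (p - (-1) ^ (n + 1) * p.comp (-X)))

theorem routhReduction_monic_and_natDegree {n : ℕ} {p : ℝ[X]} (hp : p.Monic)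
    (hn : p.natDegree = n + 1) (h0 : p.coeff n ≠ 0) :
    (routhReduction n p).Monic ∧ (routhReduction n p).natDegree = n := by
  have hlead : p.coeff (n + 1) = 1 := by rw [← hn]; exact hp
  have hq : ∀ k, ((-1) ^ (n + 1) * p.comp (-X)).coeff k = (-1) ^ (n + 1 + k) * p.coeff k := by
    intro k
    rw [show ((-1) ^ (n + 1) : ℝ[X]) = C ((-1) ^ (n + 1)) by simp, coeff_C_mul, coeff_comp_neg_X,
      pow_add]
    ring
  have hn1 : (-1 : ℝ) ^ (n + 1 + n) = -1 := by
    rw [show n + 1 + n = 2 * n + 1 by ring]; simp [pow_succ, pow_mul]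
  have hn2 : (-1 : ℝ) ^ (n + 1 + (n + 1)) = 1 := by
    rw [show n + 1 + (n + 1) = 2 * (n + 1) by ring]; simp [pow_mul]
  have hle : (routhReduction n p).natDegree ≤ n := by
    refine natDegree_le_iff_coeff_eq_zero.2 fun k hk => ?_
    obtain ⟨m, rfl⟩ : ∃ m, k = m + 1 := ⟨k - 1, by omega⟩
    rw [routhReduction, sub_mul, one_mul]
    simp only [coeff_add, coeff_sub, coeff_C_mul, coeff_X_mul, hq]
    rcases (Nat.lt_succ_iff.1 hk).eq_or_lt with rfl | hm
    · rw [hlead, hn1, hn2]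
      field_simp
      ring
    · rw [coeff_eq_zero_of_natDegree_lt (by omega : p.natDegree < m + 1)]
      rcases (Nat.succ_le_of_lt hm).eq_or_lt with rfl | hm'
      · rw [Nat.succ_eq_add_one, hn2]
        simp
      · rw [coeff_eq_zero_of_natDegree_lt (by omega : p.natDegree < m)]
        simp
  have hcoeff : (routhReduction n p).coeff n = 1 := by
    rw [routhReduction, sub_mul, one_mul]
    cases n with
    | zero =>
      simp only [coeff_add, coeff_sub, coeff_C_mul, mul_coeff_zero X, coeff_X_zero, hq, hn1]
      field_simp
      ring
    | succ m =>
      have hm : (-1 : ℝ) ^ (m + 1 + 1 + m) = 1 := by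
        rw [show m + 1 + 1 + m = 2 * (m + 1) by ring]; simp [pow_mul]
      simp only [coeff_add, coeff_sub, coeff_C_mul, coeff_X_mul, hq, hn1, hm]
      field_simp
      ring
  refine ⟨monic_of_natDegree_le_of_coeff_eq_one n hle hcoeff, le_antisymm hle ?_⟩
  exact le_natDegree_of_ne_zero (by rw [hcoeff]; exact one_ne_zero)

theorem coeff_pos_of_cRoots_re_neg {n : ℕ} {p : ℝ[X]} (hp : p.Monic) (hn : p.natDegree = n + 1)
    (hre : ∀ w ∈ cRoots p, w.re < 0) : 0 < p.coeff n := by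
  have h0 : cRoots p ≠ 0 := by
    rw [← Multiset.card_pos, card_cRoots, hn]; omega
  have h := sum_re_neg _ hre h0
  rw [hp.sum_cRoots, nextCoeff_of_natDegree_pos (by omega), hn] at h
  simpa using h

theorem routhReduction_cRoots_re_neg {n : ℕ} {p : ℝ[X]} (hp : p.Monic) (hn : p.natDegree = n + 1)
    (hre : ∀ w ∈ cRoots p, w.re < 0) : ∀ z ∈ cRoots (routhReduction n p), z.re < 0 := by
  intro z hz
  by_contra! hz0
  have hb := coeff_pos_of_cRoots_re_neg hp hn hre
  have key := re_mul_sq_norm_prod_sub_le _ hre hz0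
  rw [← hp.aeval_eq_prod_cRoots, ← hp.neg_one_pow_mul_aeval_neg, hp.sum_cRoots,
    nextCoeff_of_natDegree_pos (by omega), hn, Nat.add_sub_cancel] at key
  have hr : aeval z (routhReduction n p) = 0 := by
    have := isRoot_of_mem_roots hz
    rwa [IsRoot, eval_map_algebraMap] at this
  have hcomp : aeval z (p.comp (-X)) = aeval (-z) p := by rw [aeval_comp]; simp
  simp only [routhReduction, map_add, map_sub, map_mul, aeval_C, map_pow, map_neg, map_one,
    aeval_X, hcomp] at hr
  have hP : aeval z p ≠ 0 := by
    intro h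
    refine (hre z ?_).not_ge hz0
    rw [cRoots, mem_roots (hp.map _).ne_zero, IsRoot, eval_map_algebraMap, h]
  generalize aeval z p = P at *
  generalize (-1) ^ (n + 1) * aeval (-z) p = Q at *
  generalize p.coeff n = b at *
  have hb' : (b : ℂ) ≠ 0 := by exact_mod_cast hb.ne'
  have hr' : b * (P + Q) = (z - 1) * (P - Q) := by
    simp only [Complex.coe_algebraMap] at hr
    push_cast at hr
    field_simp at hr
    linear_combination hr
  have hre' : b * (‖P‖ ^ 2 - ‖Q‖ ^ 2) = (z.re - 1) * ‖P - Q‖ ^ 2 := by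
    have h := congrArg (fun t => (t * starRingEnd ℂ (P - Q)).re) hr'
    simp only [Complex.sq_norm, Complex.normSq_apply]
    simp at h ⊢
    linear_combination h
  have hD : P - Q = 0 := by
    have : ‖P - Q‖ ^ 2 ≤ 0 := by
      simp only [Complex.neg_re, Complex.ofReal_re, neg_neg] at key
      linarith
    exact norm_eq_zero.1 (pow_eq_zero_iff two_ne_zero |>.1 (this.antisymm (sq_nonneg _)))
  rw [hD, mul_zero] at hr'
  have hS := (mul_eq_zero.1 hr').resolve_left hb'
  exact hP (by linear_combination (hD + hS) / 2)

theorem schwarzMatrix_cons_charpoly_of_routhReduction {n : ℕ} {p : ℝ[X]} (h0 : p.coeff n ≠ 0)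
    {c : Fin n → ℝ} (hc : (schwarzMatrix c).charpoly = routhReduction n p) :
    (schwarzMatrix (Fin.cons (p.coeff n) c : Fin (n + 1) → ℝ)).charpoly = p := by
  have hs := schwarzMatrix_charpoly_comp_neg_X c
  rw [schwarzMatrix_charpoly_eq_tail, Fin.tail_cons, Fin.cons_zero]
  rw [hc] at hs ⊢
  have hε : ((-1) ^ n : ℝ[X]) * (-1) ^ n = 1 := by rw [← mul_pow]; simp
  have h2 : (C (1 / 2) : ℝ[X]) * 2 = 1 := by
    rw [← C_ofNat, ← C_mul]; norm_num
  have hb : (C (1 / (2 * p.coeff n)) : ℝ[X]) * C (p.coeff n) = C (1 / 2) := by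
    rw [← C_mul]; congr 1; field_simp
  have hQ : (schwarzMatrix (zeroHead c)).charpoly =
      C (1 / (2 * p.coeff n)) * (p - (-1) ^ (n + 1) * p.comp (-X)) := by
    refine mul_left_cancel₀ (two_ne_zero (α := ℝ[X])) ?_
    simp only [routhReduction, add_comp, sub_comp, mul_comp, pow_comp, neg_comp, one_comp, C_comp,
      X_comp, comp_neg_X_comp_neg_X, pow_succ] at hs ⊢
    generalize p.comp (-X) = p' at *
    generalize (-1 : ℝ[X]) ^ n = ε at *
    generalize (C (1 / (2 * p.coeff n)) : ℝ[X]) = k at *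
    generalize (schwarzMatrix (zeroHead c)).charpoly = Q at *
    linear_combination (-ε) * hs + (-(2 * Q - (C (1 / 2) * (p + ε * -1 * p') +
      (1 - X) * (k * (p - ε * -1 * p')))) - C (1 / 2) * p + (1 + X) * k * p) * hε
  rw [hQ, routhReduction]
  linear_combination (p - (-1) ^ (n + 1) * p.comp (-X)) * hb + p * h2

theorem exists_schwarzMatrix_charpoly_eq {n : ℕ} {p : ℝ[X]} (hp : p.Monic) (hn : p.natDegree = n)
    (hre : ∀ w ∈ cRoots p, w.re < 0) :
    ∃ b : Fin n → ℝ, (∀ i, 0 < b i) ∧ (schwarzMatrix b).charpoly = p := by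
  induction n generalizing p with
  | zero => exact ⟨Fin.elim0, fun i => i.elim0, by simp [hp.natDegree_eq_zero.1 hn]⟩
  | succ n ih =>
    have hb := coeff_pos_of_cRoots_re_neg hp hn hre
    obtain ⟨hr, hrn⟩ := routhReduction_monic_and_natDegree hp hn hb.ne'
    obtain ⟨c, hc, hcr⟩ := ih hr hrn (routhReduction_cRoots_re_neg hp hn hre)
    exact ⟨Fin.cons (p.coeff n) c, Fin.cases hb hc,
      schwarzMatrix_cons_charpoly_of_routhReduction hb.ne' hcr⟩

theorem exists_monic_cRoots_eq (Λ : Multiset ℂ) (hconj : Multiset.map (starRingEnd ℂ) Λ = Λ) :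
    ∃ p : ℝ[X], p.Monic ∧ cRoots p = Λ := by
  have hmonic : (Λ.map fun w => X - C w).prod.Monic := monic_multisetProd_X_sub_C Λ
  have hmap : (Λ.map fun w => X - C w).prod.map (starRingEnd ℂ) =
      (Λ.map fun w => X - C w).prod := by
    conv_rhs => rw [← hconj]
    rw [Polynomial.map_multiset_prod, Multiset.map_map, Multiset.map_map]
    simp
  have hlift : (Λ.map fun w => X - C w).prod ∈ lifts (algebraMap ℝ ℂ) := by
    rw [lifts_iff_coeff_lifts]
    intro k
    have hk := congrArg (fun p => p.coeff k) hmap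
    rw [coeff_map] at hk
    obtain ⟨r, hr⟩ := Complex.conj_eq_iff_real.1 hk
    exact ⟨r, hr.symm⟩
  obtain ⟨p, hpm, -, hp⟩ := lifts_and_natDegree_eq_and_monic hlift hmonic
  exact ⟨p, hp, by rw [cRoots, hpm, roots_multiset_prod_X_sub_C]⟩

theorem Polynomial.Monic.eq_of_cRoots_eq {p q : ℝ[X]} (hp : p.Monic) (hq : q.Monic)
    (h : cRoots p = cRoots q) : p = q := by
  apply map_injective _ (algebraMap ℝ ℂ).injective
  rw [hp.map_eq_prod_cRoots, hq.map_eq_prod_cRoots, h]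

/-- given `n` complex numbers with negative real parts whose multiset is
closed under conjugation, there is a unique Schwarz matrix with positive parameters
whose spectrum (with multiplicity) is that multiset. -/
theorem schwarz_stmt6 {n : ℕ} (Λ : Multiset ℂ) (hcard : Multiset.card Λ = n)
    (hconj : Multiset.map (starRingEnd ℂ) Λ = Λ)
    (hre : ∀ z ∈ Λ, z.re < 0) :
    ∃! b : Fin n → ℝ, (∀ i, 0 < b i) ∧ cRoots (schwarzMatrix b).charpoly = Λ := by
  obtain ⟨p, hp, rfl⟩ := exists_monic_cRoots_eq Λ hconj
  obtain ⟨b, hb, hbp⟩ := exists_schwarzMatrix_charpoly_eq hp (by rw [← card_cRoots, hcard]) hre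
  refine ⟨b, ⟨hb, by rw [hbp]⟩, fun c hc => schwarzMatrix_charpoly_injOn hc.1 hb ?_⟩
  exact (charpoly_monic _).eq_of_cRoots_eq (charpoly_monic _) (by simpa only [hbp] using hc.2)
end

section
/- For any real numbers λ_1, ..., λ_n satisfying λ_1 > -λ_2 > λ_3 > ⋯ > (-1)^{n-1}λ_n > 0, there exists a unique Schwarz matrix J_n with all parameters b_0, ..., b_{n-1} negative whose spectrum is {λ_1, ..., λ_n}. -/
open Polynomial Matrix

/-- The monic polynomials with `p₀ = 1`, `p₁ = X`, `p_{k+2} = X p_{k+1} - a_k p_k`. -/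
noncomputable def symmRec (a : ℕ → ℝ) : ℕ → ℝ[X]
  | 0 => 1
  | 1 => X
  | k + 2 => X * symmRec a (k + 1) - C (a k) * symmRec a k

namespace symmRec

theorem zero (a : ℕ → ℝ) : symmRec a 0 = 1 := rfl

theorem one (a : ℕ → ℝ) : symmRec a 1 = X := rfl

theorem add_two (a : ℕ → ℝ) (k : ℕ) :
    symmRec a (k + 2) = X * symmRec a (k + 1) - C (a k) * symmRec a k := rfl

theorem degree_eq_and_monic (a : ℕ → ℝ) (k : ℕ) :
    (symmRec a k).degree = k ∧ (symmRec a k).Monic := by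
  induction k using Nat.twoStepInduction with
  | zero => simp [zero]
  | one => simp [one]
  | more k h0 h1 =>
    have hd : (X * symmRec a (k + 1)).degree = ((k + 2 : ℕ) : WithBot ℕ) := by
      rw [degree_mul, h1.1, degree_X]
      norm_cast
      omega
    have hlt : (C (a k) * symmRec a k).degree < (X * symmRec a (k + 1)).degree := by
      rw [← smul_eq_C_mul]
      refine (degree_smul_le _ _).trans_lt ?_
      rw [hd, h0.1]
      exact_mod_cast (by omega : k < k + 2)
    rw [add_two]
    exact ⟨(degree_sub_eq_left_of_degree_lt hlt).trans hd, (monic_X.mul h1.2).sub_of_left hlt⟩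

theorem degree_eq (a : ℕ → ℝ) (k : ℕ) : (symmRec a k).degree = k :=
  (degree_eq_and_monic a k).1

theorem monic (a : ℕ → ℝ) (k : ℕ) : (symmRec a k).Monic :=
  (degree_eq_and_monic a k).2

theorem natDegree_eq (a : ℕ → ℝ) (k : ℕ) : (symmRec a k).natDegree = k :=
  natDegree_eq_of_degree_eq_some (degree_eq a k)

theorem comp_neg_X (a : ℕ → ℝ) (k : ℕ) :
    (symmRec a k).comp (-X) = (-1) ^ k * symmRec a k := by
  induction k using Nat.twoStepInduction with
  | zero => simp [zero]
  | one => simp [one]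
  | more k h0 h1 =>
    simp only [add_two, sub_comp, mul_comp, X_comp, C_comp, h0, h1]
    ring

theorem sq_mem_range_expand (a : ℕ → ℝ) (k : ℕ) :
    symmRec a k ^ 2 ∈ (expand ℝ 2).range := by
  suffices h : symmRec a k ^ 2 ∈ (expand ℝ 2).range ∧
      symmRec a (k + 1) ^ 2 ∈ (expand ℝ 2).range ∧
      X * (symmRec a (k + 1) * symmRec a k) ∈ (expand ℝ 2).range from h.1
  have hX : (X ^ 2 : ℝ[X]) ∈ (expand ℝ 2).range := ⟨X, by simp⟩
  have hC (c : ℝ) : C c ∈ (expand ℝ 2).range := ⟨C c, by simp⟩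
  induction k with
  | zero =>
    refine ⟨by simp [zero, one_mem], by simpa [one] using hX, ?_⟩
    simpa [one, zero, ← sq] using hX
  | succ k ih =>
    obtain ⟨h0, h1, h2⟩ := ih
    refine ⟨h1, ?_, ?_⟩
    · have : symmRec a (k + 2) ^ 2 = X ^ 2 * symmRec a (k + 1) ^ 2
          - C (2 * a k) * (X * (symmRec a (k + 1) * symmRec a k))
          + C (a k ^ 2) * symmRec a k ^ 2 := by
        rw [add_two]
        simp only [map_mul, map_pow, map_ofNat]
        ring
      rw [this]
      exact add_mem (sub_mem (mul_mem hX h1) (mul_mem (hC _) h2)) (mul_mem (hC _) h0)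
    · have : X * (symmRec a (k + 2) * symmRec a (k + 1)) = X ^ 2 * symmRec a (k + 1) ^ 2
          - C (a k) * (X * (symmRec a (k + 1) * symmRec a k)) := by
        rw [add_two]
        ring
      rw [this]
      exact sub_mem (mul_mem hX h1) (mul_mem (hC _) h2)

theorem exists_expand_eq_sq (a : ℕ → ℝ) (k : ℕ) :
    ∃ q : ℝ[X], q.Monic ∧ q.natDegree = k ∧ expand ℝ 2 q = symmRec a k ^ 2 := by
  obtain ⟨q, hq⟩ := sq_mem_range_expand a k
  have hq' : expand ℝ 2 q = symmRec a k ^ 2 := hq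
  refine ⟨q, (monic_expand_iff two_pos).1 (hq' ▸ (monic a k).pow 2), ?_, hq'⟩
  have h := congrArg natDegree hq'
  rw [natDegree_expand, natDegree_pow, natDegree_eq] at h
  omega

/-- The coefficients can be prescribed recursively in terms of the polynomials built so far. -/
theorem exists_coeff_eq (Φ : ℕ → ℝ[X] → ℝ[X] → ℝ) :
    ∃ a : ℕ → ℝ, ∀ k, a k = Φ k (symmRec a k) (symmRec a (k + 1)) := by
  let s : ℕ → ℝ[X] × ℝ[X] := fun k => Nat.rec (1, X)
    (fun k p => (p.2, X * p.2 - C (Φ k p.1 p.2) * p.1)) k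
  have hs (k : ℕ) : s (k + 1) = ((s k).2, X * (s k).2 - C (Φ k (s k).1 (s k).2) * (s k).1) := rfl
  refine ⟨fun k => Φ k (s k).1 (s k).2, fun k => ?_⟩
  have key : symmRec (fun k => Φ k (s k).1 (s k).2) k = (s k).1 ∧
      symmRec (fun k => Φ k (s k).1 (s k).2) (k + 1) = (s k).2 := by
    induction k with
    | zero => exact ⟨rfl, rfl⟩
    | succ k ih =>
      refine ⟨ih.2, ?_⟩
      rw [add_two, ih.1, ih.2, hs]
  rw [key.1, key.2]

theorem coeff_unique {a a' : ℕ → ℝ} (k : ℕ) (ha : ∀ i < k, a i ≠ 0)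
    (h1 : symmRec a (k + 1) = symmRec a' (k + 1)) (h0 : symmRec a k = symmRec a' k) :
    ∀ i < k, a i = a' i := by
  induction k with
  | zero => simp
  | succ k ih =>
    have h : C (a k) * symmRec a k = C (a' k) * symmRec a' k := by
      rw [add_two, add_two, h0] at h1
      exact sub_right_injective h1
    have hk : a k = a' k := by
      simpa [(monic _ _).leadingCoeff] using congrArg leadingCoeff h
    rw [← hk] at h
    have h' := mul_left_cancel₀ (C_ne_zero.2 (ha k k.lt_succ_self)) h
    intro i hi
    rcases Nat.lt_succ_iff_lt_or_eq.1 hi with hi | rfl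
    · exact ih (fun i hi => ha i (by omega)) h0 h' i hi
    · exact hk

theorem coeff_unique_of_sub {a a' : ℕ → ℝ} (m : ℕ) (ha : ∀ i ≤ m, a i ≠ 0)
    (h : symmRec a (m + 1) - C (a m) * symmRec a m =
      symmRec a' (m + 1) - C (a' m) * symmRec a' m) :
    ∀ i ≤ m, a i = a' i := by
  have hc := congrArg (fun p : ℝ[X] => (-1) ^ (m + 1) * p.comp (-X)) h
  have hs : ((-1 : ℝ[X]) ^ m) ^ 2 = 1 := by rw [← pow_mul, mul_comm, pow_mul]; simp
  simp only [sub_comp, mul_comp, C_comp, comp_neg_X] at hc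
  have hc' : symmRec a (m + 1) + C (a m) * symmRec a m =
      symmRec a' (m + 1) + C (a' m) * symmRec a' m := by
    linear_combination hc + (- (symmRec a (m + 1) + C (a m) * symmRec a m) +
      (symmRec a' (m + 1) + C (a' m) * symmRec a' m)) * hs
  have h2 : (2 : ℝ[X]) ≠ 0 := two_ne_zero
  have e1 : symmRec a (m + 1) = symmRec a' (m + 1) :=
    mul_left_cancel₀ h2 (by linear_combination h + hc')
  have e0 : C (a m) * symmRec a m = C (a' m) * symmRec a' m := by
    linear_combination hc' - e1
  have hm : a m = a' m := by
    simpa [(monic _ _).leadingCoeff] using congrArg leadingCoeff e0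
  rw [← hm] at e0
  have e0' := mul_left_cancel₀ (C_ne_zero.2 (ha m le_rfl)) e0
  intro i hi
  rcases hi.lt_or_eq with hi | rfl
  · exact coeff_unique m (fun i hi => ha i hi.le) e1 e0' i hi
  · exact hm

section Functional

variable (L : ℝ[X] →ₗ[ℝ] ℝ)

theorem map_C_mul (c : ℝ) (p : ℝ[X]) : L (C c * p) = c * L p := by
  rw [← smul_eq_C_mul, map_smul, smul_eq_mul]

theorem map_mul_eq_zero_of_degree_lt {a : ℕ → ℝ} {R : ℝ[X]} (n : ℕ)
    (hR : ∀ j < n, L (R * symmRec a j) = 0) (D : ℝ[X]) (hD : D.degree < n) :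
    L (R * D) = 0 := by
  induction n generalizing D with
  | zero =>
    have : D = 0 := by simpa using hD
    simp [this]
  | succ n ih =>
    have h := ih (fun j hj => hR j (by omega)) (D - C (D.coeff n) * symmRec a n) (by
      rw [degree_lt_iff_coeff_zero] at hD ⊢
      intro k hk
      rcases hk.lt_or_eq with hk | rfl
      · have : (symmRec a n).coeff k = 0 :=
          coeff_eq_zero_of_natDegree_lt (by rwa [natDegree_eq])
        simp [this, hD k hk]
      · have : (symmRec a n).coeff n = 1 := by
          simpa [natDegree_eq] using (monic a n).coeff_natDegree
        simp [this])
    rw [mul_sub, map_sub, mul_left_comm, map_C_mul, hR n n.lt_succ_self] at h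
    simpa using h

theorem map_mul_eq_zero_step {a : ℕ → ℝ} (k : ℕ)
    (ho : ∀ i ≤ k, ∀ j < i, L (symmRec a i * symmRec a j) = 0)
    (ha : ∀ i < k, a i * L (symmRec a i ^ 2) = L (symmRec a (i + 1) ^ 2)) :
    ∀ j < k, L (symmRec a (k + 1) * symmRec a j) = 0 := by
  intro j hj
  obtain ⟨k, rfl⟩ : ∃ l, k = l + 1 := ⟨k - 1, by omega⟩
  have hX : L (symmRec a (k + 1) * (X * symmRec a j)) =
      L (symmRec a (k + 1) * symmRec a (j + 1)) := by
    cases j with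
    | zero => simp [zero, one]
    | succ j =>
      have : symmRec a (k + 1) * (X * symmRec a (j + 1)) =
          symmRec a (k + 1) * symmRec a (j + 2) +
            C (a j) * (symmRec a (k + 1) * symmRec a j) := by
        rw [add_two]
        ring
      rw [this, map_add, map_C_mul, ho (k + 1) le_rfl j (by omega)]
      simp
  have h : symmRec a (k + 2) * symmRec a j = symmRec a (k + 1) * (X * symmRec a j) -
      C (a k) * (symmRec a k * symmRec a j) := by
    rw [add_two]
    ring
  rw [h, map_sub, map_C_mul, hX]
  rcases Nat.lt_succ_iff_lt_or_eq.1 hj with hj | rfl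
  · rw [ho (k + 1) le_rfl (j + 1) (by omega), ho k (by omega) j hj]
    simp
  · rw [← sq, ← sq, ha j (by omega), sub_self]

theorem map_succ_mul_self {a : ℕ → ℝ} (k : ℕ)
    (ho : ∀ i ≤ k, ∀ j < i, L (symmRec a i * symmRec a j) = 0) :
    L (symmRec a (k + 1) * symmRec a k) = L (X * symmRec a k ^ 2) := by
  cases k with
  | zero => simp [zero, one]
  | succ k =>
    have h : symmRec a (k + 2) * symmRec a (k + 1) = X * symmRec a (k + 1) ^ 2 -
        C (a k) * (symmRec a (k + 1) * symmRec a k) := by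
      rw [add_two]
      ring
    rw [h, map_sub, map_C_mul, ho (k + 1) le_rfl k (by omega)]
    simp

theorem exists_sub_eq {m : ℕ} {P : ℝ[X]} (hP : P.Monic) (hdeg : P.natDegree = m + 1)
    (hPL : ∀ D, L (P * D) = 0)
    (hpos : ∀ p : ℝ[X], p ≠ 0 → p.degree < (m + 1 : ℕ) → 0 < L (p ^ 2))
    (hX : ∀ q : ℝ[X], q.natDegree ≤ m → L (X * expand ℝ 2 q) = q.coeff m) :
    ∃ a : ℕ → ℝ, (∀ k ≤ m, 0 < a k) ∧ symmRec a (m + 1) - C (a m) * symmRec a m = P := by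
  obtain ⟨a, ha⟩ := exists_coeff_eq
    (fun k p r => if k < m then L (r ^ 2) / L (p ^ 2) else 1 / L (p ^ 2))
  have hsq (k : ℕ) (hk : k ≤ m) : 0 < L (symmRec a k ^ 2) :=
    hpos _ (monic a k).ne_zero (by rw [degree_eq]; exact_mod_cast Nat.lt_succ_of_le hk)
  have hlt (k : ℕ) (hk : k < m) : a k * L (symmRec a k ^ 2) = L (symmRec a (k + 1) ^ 2) := by
    rw [ha k, if_pos hk, div_mul_cancel₀ _ (hsq k hk.le).ne']
  have hm : a m * L (symmRec a m ^ 2) = 1 := by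
    rw [ha m, if_neg (lt_irrefl m), div_mul_cancel₀ _ (hsq m le_rfl).ne']
  have hodd (k : ℕ) (hk : k ≤ m) : L (X * symmRec a k ^ 2) = if k = m then 1 else 0 := by
    obtain ⟨q, hq, hqd, hqe⟩ := exists_expand_eq_sq a k
    rw [← hqe, hX q (by omega)]
    split_ifs with h
    · rw [← h, ← hqd, hq.coeff_natDegree]
    · exact coeff_eq_zero_of_natDegree_lt (by omega)
  have ho (k : ℕ) (hk : k ≤ m) :
      ∀ i ≤ k, ∀ j < i, L (symmRec a i * symmRec a j) = 0 := by
    induction k with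
    | zero => intro i hi j hj; omega
    | succ k ih =>
      have ih := ih (by omega)
      intro i hi j hj
      rcases hi.lt_or_eq with hi | rfl
      · exact ih i (by omega) j hj
      rcases Nat.lt_succ_iff_lt_or_eq.1 hj with hj | rfl
      · exact map_mul_eq_zero_step L k ih (fun i hi => hlt i (by omega)) j hj
      · rw [map_succ_mul_self L j ih, hodd j (by omega), if_neg (by omega)]
  refine ⟨a, fun k hk => ?_, ?_⟩
  · rcases hk.lt_or_eq with hk | rfl
    · exact pos_of_mul_pos_left (by rw [hlt k hk]; exact hsq _ hk) (hsq k hk.le).le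
    · exact pos_of_mul_pos_left (by rw [hm]; exact one_pos) (hsq k le_rfl).le
  have hR : ∀ j < m + 1,
      L ((symmRec a (m + 1) - C (a m) * symmRec a m) * symmRec a j) = 0 := by
    intro j hj
    rw [sub_mul, map_sub, mul_assoc, map_C_mul]
    rcases Nat.lt_succ_iff_lt_or_eq.1 hj with hj | rfl
    · rw [map_mul_eq_zero_step L m (ho m le_rfl) hlt j hj, ho m le_rfl m le_rfl j hj]
      simp
    · rw [map_succ_mul_self L j (ho j le_rfl), hodd j le_rfl, ← sq, hm]
      simp
  have hdlt : (C (a m) * symmRec a m).degree < (symmRec a (m + 1)).degree := by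
    rw [← smul_eq_C_mul]
    refine (degree_smul_le _ _).trans_lt ?_
    rw [degree_eq, degree_eq]
    exact_mod_cast m.lt_succ_self
  have hRd := (degree_sub_eq_left_of_degree_lt hdlt).trans (degree_eq a (m + 1))
  have hRm := (monic a (m + 1)).sub_of_left hdlt
  set R := symmRec a (m + 1) - C (a m) * symmRec a m
  have hD : (R - P).degree < (m + 1 : ℕ) := by
    rw [← hRd]
    refine degree_sub_lt_left ?_ hRm.ne_zero (by rw [hRm.leadingCoeff, hP.leadingCoeff])
    rw [hRd, degree_eq_natDegree hP.ne_zero, hdeg]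
  by_contra hne
  refine (hpos _ (sub_ne_zero.2 hne) hD).ne' ?_
  rw [sq, sub_mul, map_sub, hPL, map_mul_eq_zero_of_degree_lt L (m + 1) hR _ hD, sub_zero]

end Functional

end symmRec

/-- The tridiagonal matrix over `ℝ[X]` whose determinant is `symmRec a n` for `d = 0`. -/
noncomputable def symmRecMatrix (a : ℕ → ℝ) (d : ℝ) (n : ℕ) : Matrix (Fin n) (Fin n) ℝ[X] :=
  Matrix.of fun i j : Fin n =>
    if (i : ℕ) = (j : ℕ) then (if (i : ℕ) = 0 then X - C d else X)
    else if (i : ℕ) + 1 = (j : ℕ) then -1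
    else if (i : ℕ) = (j : ℕ) + 1 then -C (a (n - 1 - i))
    else 0

theorem det_symmRecMatrix_add_two (a : ℕ → ℝ) (d : ℝ) (n : ℕ) :
    (symmRecMatrix a d (n + 2)).det = (X - C d) * (symmRecMatrix a 0 (n + 1)).det
      - C (a n) * (symmRecMatrix a 0 n).det := by
  have h0 : (symmRecMatrix a d (n + 2)).submatrix Fin.succ Fin.succ =
      symmRecMatrix a 0 (n + 1) := by
    ext1 i j
    simp only [symmRecMatrix, submatrix_apply, of_apply, Fin.val_succ]
    simp
  have h1 : ((symmRecMatrix a d (n + 2)).submatrix Fin.succ (Fin.succAbove 1)).det =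
      -C (a n) * (symmRecMatrix a 0 n).det := by
    rw [det_succ_column_zero, Fin.sum_univ_succ, Finset.sum_eq_zero]
    · have : (symmRecMatrix a d (n + 2)).submatrix (Fin.succ ∘ Fin.succ)
          (Fin.succAbove 1 ∘ Fin.succ) = symmRecMatrix a 0 n := by
        ext1 i j
        have : n - (i + 1 : ℕ) = n - 1 - i := by omega
        have h : (Fin.succAbove 1 j.succ : Fin (n + 2)) = j.succ.succ := by
          ext; simp [Fin.succAbove, Fin.lt_def]
        simp [symmRecMatrix, h, this]
      simp [this]
      simp [symmRecMatrix]
    · intro i _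
      simp [symmRecMatrix]
  rw [det_succ_row_zero, Fin.sum_univ_succ, Fin.sum_univ_succ, Finset.sum_eq_zero]
  · simp only [Fin.succAbove_zero, h0, Fin.succ_zero_eq_one, h1]
    simp [symmRecMatrix]
    ring
  · intro i _
    simp [symmRecMatrix]

theorem det_symmRecMatrix_zero (a : ℕ → ℝ) (n : ℕ) :
    (symmRecMatrix a 0 n).det = symmRec a n := by
  induction n using Nat.twoStepInduction with
  | zero => simp [symmRec.zero]
  | one => simp [symmRec.one, symmRecMatrix]
  | more n h0 h1 => simp [det_symmRecMatrix_add_two, h0, h1, symmRec.add_two]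

theorem det_symmRecMatrix_succ (a : ℕ → ℝ) (d : ℝ) (m : ℕ) :
    (symmRecMatrix a d (m + 1)).det = symmRec a (m + 1) - C d * symmRec a m := by
  cases m with
  | zero => simp [symmRec.zero, symmRec.one, symmRecMatrix]
  | succ m =>
    rw [det_symmRecMatrix_add_two, det_symmRecMatrix_zero, det_symmRecMatrix_zero,
      symmRec.add_two]
    ring

theorem charpoly_schwarzMatrix {m : ℕ} (a : ℕ → ℝ) :
    (schwarzMatrix fun i : Fin (m + 1) => -a (m - i)).charpoly =
      symmRec a (m + 1) - C (a m) * symmRec a m := by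
  rw [← det_symmRecMatrix_succ, Matrix.charpoly]
  congr 1
  ext1 i j
  rw [charmatrix_apply, diagonal_apply]
  simp only [schwarzMatrix, symmRecMatrix, of_apply, Fin.ext_iff]
  split_ifs <;> first | omega | simp_all

/-- The weights `1 / (λᵢ ∏_{j ≠ i} (λᵢ² - λⱼ²))` are positive for alternating `λ`. -/
theorem weight_pos {n : ℕ} (lam : Fin n → ℝ)
    (h1 : StrictAnti (fun i : Fin n => (-1 : ℝ) ^ (i : ℕ) * lam i))
    (h2 : ∀ i : Fin n, 0 < (-1 : ℝ) ^ (i : ℕ) * lam i) (i : Fin n) :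
    0 < lam i * ∏ j ∈ Finset.univ.erase i, (lam i ^ 2 - lam j ^ 2) := by
  have hsq (j : Fin n) : ((-1 : ℝ) ^ (j : ℕ) * lam j) ^ 2 = lam j ^ 2 := by
    rw [mul_pow, ← pow_mul, mul_comm (j : ℕ), pow_mul]; simp
  have hlt {j k : Fin n} (h : j < k) : lam k ^ 2 < lam j ^ 2 := by
    rw [← hsq j, ← hsq k]
    exact pow_lt_pow_left₀ (h1 h) (h2 k).le two_ne_zero
  have hsplit : Finset.univ.erase i = Finset.Iio i ∪ Finset.Ioi i := by
    ext j
    simp [lt_or_lt_iff_ne]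
  have hdisj : Disjoint (Finset.Iio i) (Finset.Ioi i) :=
    Finset.disjoint_left.2 fun j hj hj' =>
      lt_asymm (Finset.mem_Iio.1 hj) (Finset.mem_Ioi.1 hj')
  rw [hsplit, Finset.prod_union hdisj]
  have hneg : ∏ j ∈ Finset.Iio i, (lam i ^ 2 - lam j ^ 2) =
      (-1) ^ (i : ℕ) * ∏ j ∈ Finset.Iio i, (lam j ^ 2 - lam i ^ 2) := by
    rw [← Fin.card_Iio i, ← Finset.prod_const, ← Finset.prod_mul_distrib]
    exact Finset.prod_congr rfl fun j _ => by ring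
  have e : lam i * ((∏ j ∈ Finset.Iio i, (lam i ^ 2 - lam j ^ 2)) *
      ∏ j ∈ Finset.Ioi i, (lam i ^ 2 - lam j ^ 2)) =
      ((-1) ^ (i : ℕ) * lam i) * ((∏ j ∈ Finset.Iio i, (lam j ^ 2 - lam i ^ 2)) *
      ∏ j ∈ Finset.Ioi i, (lam i ^ 2 - lam j ^ 2)) := by
    rw [hneg]; ring
  rw [e]
  refine mul_pos (h2 i) (mul_pos ?_ ?_) <;>
    refine Finset.prod_pos fun j hj => sub_pos.2 (hlt ?_)
  · exact Finset.mem_Iio.1 hj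
  · exact Finset.mem_Ioi.1 hj

theorem exists_symmRec_eq_prod {m : ℕ} (lam : Fin (m + 1) → ℝ)
    (h1 : StrictAnti (fun i : Fin (m + 1) => (-1 : ℝ) ^ (i : ℕ) * lam i))
    (h2 : ∀ i : Fin (m + 1), 0 < (-1 : ℝ) ^ (i : ℕ) * lam i) :
    ∃ a : ℕ → ℝ, (∀ k ≤ m, 0 < a k) ∧
      symmRec a (m + 1) - C (a m) * symmRec a m = ∏ i, (X - C (lam i)) := by
  have hw := weight_pos lam h1 h2
  set w : Fin (m + 1) → ℝ :=
    fun i => lam i * ∏ j ∈ Finset.univ.erase i, (lam i ^ 2 - lam j ^ 2) with hwdef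
  have hinj : Function.Injective fun i => lam i ^ 2 := by
    intro i j hij
    by_contra hne
    refine (hw i).ne' (mul_eq_zero_of_right _ (Finset.prod_eq_zero (i := j) ?_ ?_))
    · simpa using Ne.symm hne
    · exact sub_eq_zero.2 hij
  have hinj' : Function.Injective lam := fun i j hij => hinj (congrArg (· ^ 2) hij)
  let L : ℝ[X] →ₗ[ℝ] ℝ := ∑ i, (w i)⁻¹ • leval (lam i)
  have hL (p : ℝ[X]) : L p = ∑ i, (w i)⁻¹ * p.eval (lam i) := by
    simp [L, leval]
  refine symmRec.exists_sub_eq L (monic_prod_X_sub_C _ _) (by simp) ?_ ?_ ?_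
  · intro D
    rw [hL]
    refine Finset.sum_eq_zero fun i _ => ?_
    rw [eval_mul, eval_prod, Finset.prod_eq_zero (Finset.mem_univ i) (by simp)]
    simp
  · intro p hp hd
    rw [hL]
    simp only [eval_pow]
    obtain ⟨i, hi⟩ : ∃ i, p.eval (lam i) ≠ 0 := by
      by_contra! h
      refine hp (eq_zero_of_natDegree_lt_card_of_eval_eq_zero p hinj' h ?_)
      rw [Fintype.card_fin]
      exact (natDegree_lt_iff_degree_lt hp).2 hd
    refine Finset.sum_pos' (fun j _ => mul_nonneg (inv_pos.2 (hw j)).le (sq_nonneg _))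
      ⟨i, Finset.mem_univ i, mul_pos (inv_pos.2 (hw i)) (by positivity)⟩
  · intro q hq
    have h := Lagrange.coeff_eq_sum (s := Finset.univ) (v := fun i => lam i ^ 2) hinj.injOn
      (P := q) (by
        rw [Finset.card_univ, Fintype.card_fin]
        exact degree_le_natDegree.trans_lt (by exact_mod_cast Nat.lt_succ_of_le hq))
    rw [Finset.card_univ, Fintype.card_fin, Nat.add_sub_cancel] at h
    rw [h, hL]
    refine Finset.sum_congr rfl fun i _ => ?_
    have hne := (hw i).ne'
    simp only [hwdef] at hne ⊢
    rw [eval_mul, eval_X, expand_eval, mul_inv, div_eq_mul_inv]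
    have := left_ne_zero_of_mul hne
    field_simp

/-- for real numbers `λ₁ > -λ₂ > λ₃ > ⋯ > (-1)^{n-1} λ_n > 0` there exists a
unique Schwarz matrix with all parameters negative whose spectrum is `{λ₁, …, λ_n}`. -/
theorem schwarz_stmt8 {n : ℕ} (lam : Fin n → ℝ)
    (h1 : StrictAnti (fun i : Fin n => (-1 : ℝ) ^ (i : ℕ) * lam i))
    (h2 : ∀ i : Fin n, 0 < (-1 : ℝ) ^ (i : ℕ) * lam i) :
    ∃! b : Fin n → ℝ, (∀ i, b i < 0) ∧
      (schwarzMatrix b).charpoly = ∏ i, (Polynomial.X - Polynomial.C (lam i)) := by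
  cases n with
  | zero =>
    exact ⟨fun i => i.elim0, ⟨fun i => i.elim0, by simp⟩, fun b _ => Subsingleton.elim _ _⟩
  | succ m =>
    obtain ⟨a, ha, haP⟩ := exists_symmRec_eq_prod lam h1 h2
    refine ⟨fun i => -a (m - i), ⟨fun i => neg_neg_of_pos (ha _ (Nat.sub_le _ _)),
      (charpoly_schwarzMatrix a).trans haP⟩, ?_⟩
    rintro b ⟨-, hb⟩
    obtain ⟨a', rfl⟩ : ∃ a' : ℕ → ℝ, b = fun i : Fin (m + 1) => -a' (m - i) := by
      refine ⟨fun k => -b (Fin.ofNat (m + 1) (m - k)), funext fun i => ?_⟩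
      have hi : m - (m - (i : ℕ)) = i := by omega
      simp [hi]
    rw [charpoly_schwarzMatrix, ← haP] at hb
    have h := symmRec.coeff_unique_of_sub m (fun i hi => (ha i hi).ne') hb.symm
    exact funext fun i => congrArg Neg.neg (h _ (Nat.sub_le _ _)).symm
end

section
/- Let n = 2l+1 be odd, and let S_n be the Schwarz-type matrix with (1,1) entry -a where a > 0, subdiagonal entries -c_1, ..., -c_k, c_{k+1}, ..., c_{n-1} (first k negative-signed, the rest positive-signed) with all c_i > 0 and k = 2m+1 odd, and superdiagonal entries 1. Then the characteristic polynomial of S_n is generalized Hurwitz of type I of order l - m. -/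
open Polynomial Matrix

open Classical in
/-- A real polynomial `p` of degree `n` is a *generalized Hurwitz polynomial of type I of
order `κ`*: it has exactly `κ` roots in the closed right half-plane, all of them
nonnegative, real and simple, `0 ≤ μ₁ < μ₂ < ⋯ < μ_κ`, with `p(-μ_i) ≠ 0` (for `i ≥ 2`,
and for `i = 1` whenever `μ₁ > 0`); `p` has an odd number of roots (with multiplicity)
in each interval `(-μ_{i+1}, -μ_i)` and an even number in `(-μ₁, 0)`; the remaining real
roots lie in `(-∞, -μ_κ)`, in odd number when `n` is even and even number when `n` is
odd; and all nonreal roots of `p` lie in the open left half-plane. -/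
noncomputable def GenHurwitzI (n κ : ℕ) (p : Polynomial ℝ) : Prop :=
  ∃ μ : Fin κ → ℝ, StrictMono μ ∧ (∀ i, 0 ≤ μ i) ∧
    (∀ i, p.rootMultiplicity (μ i) = 1) ∧
    (∀ i, p.IsRoot (μ i)) ∧
    (∀ z ∈ cRoots p, 0 ≤ z.re → ∃ i, z = (μ i : ℂ)) ∧
    (∀ z ∈ cRoots p, z.im ≠ 0 → z.re < 0) ∧
    (∀ i : Fin κ, (0 < (i : ℕ) ∨ 0 < μ i) → ¬p.IsRoot (-μ i)) ∧
    (∀ i : Fin κ, ∀ h : (i : ℕ) + 1 < κ,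
      Odd (Multiset.card
        (p.roots.filter fun x => -μ ⟨(i : ℕ) + 1, h⟩ < x ∧ x < -μ i))) ∧
    (∀ h : 0 < κ,
      Even (Multiset.card (p.roots.filter fun x => -μ ⟨0, h⟩ < x ∧ x < 0))) ∧
    (∀ h : 0 < κ,
      (Even n ↔
        Odd (Multiset.card
          (p.roots.filter fun x => x < -μ ⟨κ - 1, Nat.sub_lt h Nat.one_pos⟩))))

/-- The Schwarz-type matrix `S_n` with `(1,1)` entry `-a`, superdiagonal `1`, and
subdiagonal entries `-c₁, …, -c_k, c_{k+1}, …, c_{n-1}` (the first `k` taken with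
negative sign and the rest with positive sign). -/
def signedSchwarz (n : ℕ) (a : ℝ) (k : ℕ) (c : Fin (n - 1) → ℝ) :
    Matrix (Fin n) (Fin n) ℝ :=
  Matrix.of fun i j : Fin n =>
    if (i : ℕ) = 0 ∧ (j : ℕ) = 0 then -a
    else if (i : ℕ) + 1 = (j : ℕ) then 1
    else if h : (i : ℕ) = (j : ℕ) + 1 then
      (if (j : ℕ) < k then -c ⟨(j : ℕ), by have := i.isLt; omega⟩
       else c ⟨(j : ℕ), by have := i.isLt; omega⟩)
    else 0

/-- Signs of two sequences coupled by a continuant-type recurrence. -/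
lemma coupled_neg {κ : ℕ} (hκ : 1 ≤ κ) {θ q U T : ℕ → ℝ} {s : ℝ} (hs : 0 < s)
    (hneg : ∀ j, j + 1 < 2 * κ → θ j < 0) (hpos : ∀ j, 2 * κ ≤ j + 1 → 0 < θ j)
    (hq : ∀ j, 0 ≤ q j) (hq1 : 0 < q 1) (hU0 : U 0 = 0) (hT0 : 0 < T 0)
    (hU : ∀ j, U (j + 1) = -θ j * T j) (hT : ∀ j, T (j + 1) = s * q (j + 1) - θ j * U j)
    (m : ℕ) : U (2 * κ + 2 * m) < 0 := by
  have tail : ∀ j, j < 2 * κ → 0 < T j ∧ (0 < U j ∨ j = 0) := by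
    intro j
    induction j with
    | zero => intro _; exact ⟨hT0, Or.inr rfl⟩
    | succ j ih =>
      intro hj
      obtain ⟨h1, h2⟩ := ih (by omega)
      have hθ := hneg j hj
      refine ⟨?_, Or.inl (by rw [hU]; nlinarith)⟩
      rw [hT]
      rcases h2 with h2 | rfl
      · have := mul_nonneg hs.le (hq (j + 1))
        nlinarith
      · rw [hU0]
        have := mul_pos hs hq1
        simpa using this
  induction m with
  | zero =>
    obtain ⟨j, hj⟩ : ∃ j, 2 * κ = j + 1 := ⟨2 * κ - 1, by omega⟩
    have h1 := (tail j (by omega)).1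
    have h2 := hpos j (by omega)
    rw [mul_zero, add_zero, hj, hU]
    nlinarith
  | succ m ih =>
    have h1 := hpos (2 * κ + 2 * m) (by omega)
    have h2 := hpos (2 * κ + 2 * m + 1) (by omega)
    have h3 := mul_nonneg hs.le (hq (2 * κ + 2 * m + 1))
    have h4 : 0 < T (2 * κ + 2 * m + 1) := by rw [hT]; nlinarith
    rw [show 2 * κ + 2 * (m + 1) = 2 * κ + 2 * m + 1 + 1 by ring, hU]
    nlinarith

/-- The monic polynomials with `E₀ = 1`, `E₁ = X`, `E_{j+2} = X E_{j+1} + θ_j E_j`. -/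
noncomputable def continuantSeq (θ : ℕ → ℝ) : ℕ → ℝ[X]
  | 0 => 1
  | 1 => X
  | j + 2 => X * continuantSeq θ (j + 1) + C (θ j) * continuantSeq θ j

section ContinuantSeq

variable (θ : ℕ → ℝ)

lemma continuantSeq_add_two (j : ℕ) : continuantSeq θ (j + 2) =
    X * continuantSeq θ (j + 1) + C (θ j) * continuantSeq θ j := by
  rw [continuantSeq]

lemma continuantSeq_monic_natDegree (j : ℕ) :
    (continuantSeq θ j).Monic ∧ (continuantSeq θ j).natDegree = j := by
  induction j using Nat.strong_induction_on with
  | _ j ih =>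
    match j with
    | 0 => simp [continuantSeq]
    | 1 => simp [continuantSeq, monic_X]
    | j + 2 =>
      obtain ⟨hm, hd⟩ := ih (j + 1) (by omega)
      obtain ⟨hm', hd'⟩ := ih j (by omega)
      have hX : (X * continuantSeq θ (j + 1)).Monic := monic_X.mul hm
      have hXd : (X * continuantSeq θ (j + 1)).natDegree = j + 2 := by
        rw [monic_X.natDegree_mul hm, hd, natDegree_X]; ring
      have hlt : (C (θ j) * continuantSeq θ j).natDegree < j + 2 :=
        (natDegree_C_mul_le _ _).trans_lt (by omega)
      rw [continuantSeq_add_two]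
      refine ⟨hX.add_of_left (degree_lt_degree (by omega)), ?_⟩
      rw [natDegree_add_eq_left_of_natDegree_lt (by omega), hXd]

lemma continuantSeq_monic (j : ℕ) : (continuantSeq θ j).Monic :=
  (continuantSeq_monic_natDegree θ j).1

lemma continuantSeq_natDegree (j : ℕ) : (continuantSeq θ j).natDegree = j :=
  (continuantSeq_monic_natDegree θ j).2

lemma continuantSeq_eval_add_two (j : ℕ) (x : ℝ) : (continuantSeq θ (j + 2)).eval x =
    x * (continuantSeq θ (j + 1)).eval x + θ j * (continuantSeq θ j).eval x := by
  simp [continuantSeq_add_two]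

lemma continuantSeq_aeval_add_two (j : ℕ) (z : ℂ) : aeval z (continuantSeq θ (j + 2)) =
    z * aeval z (continuantSeq θ (j + 1)) + θ j * aeval z (continuantSeq θ j) := by
  simp [continuantSeq_add_two]

lemma continuantSeq_eval_derivative_add_two (j : ℕ) (x : ℝ) :
    (derivative (continuantSeq θ (j + 2))).eval x =
      (continuantSeq θ (j + 1)).eval x + x * (derivative (continuantSeq θ (j + 1))).eval x +
        θ j * (derivative (continuantSeq θ j)).eval x := by
  simp [continuantSeq_add_two]

lemma continuantSeq_eval_neg (j : ℕ) (x : ℝ) :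
    (continuantSeq θ j).eval (-x) = (-1) ^ j * (continuantSeq θ j).eval x := by
  induction j using Nat.strong_induction_on with
  | _ j ih =>
    match j with
    | 0 => simp [continuantSeq]
    | 1 => simp [continuantSeq]
    | j + 2 =>
      rw [continuantSeq_eval_add_two, continuantSeq_eval_add_two, ih _ (by omega),
        ih _ (by omega)]
      ring

lemma conj_aeval_continuantSeq_of_re_eq_zero (j : ℕ) {z : ℂ} (hz : z.re = 0) :
    (starRingEnd ℂ) (aeval z (continuantSeq θ j)) = (-1) ^ j * aeval z (continuantSeq θ j) := by
  have hc : (starRingEnd ℂ) z = -z := by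
    apply Complex.ext <;> simp [hz]
  induction j using Nat.strong_induction_on with
  | _ j ih =>
    match j with
    | 0 => simp [continuantSeq]
    | 1 => simp [continuantSeq, hc]
    | j + 2 =>
      rw [continuantSeq_aeval_add_two, map_add, map_mul, map_mul, ih _ (by omega),
        ih _ (by omega), hc, Complex.conj_ofReal]
      ring

variable {θ}

lemma continuantSeq_aeval_ne_zero (hθ : ∀ j, θ j ≠ 0) (z : ℂ) (j : ℕ)
    (h : aeval z (continuantSeq θ j) = 0) : aeval z (continuantSeq θ (j + 1)) ≠ 0 := by
  induction j with
  | zero => simp [continuantSeq] at h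
  | succ j ih =>
    intro h'
    rw [continuantSeq_aeval_add_two, h, mul_zero, zero_add] at h'
    have := hθ j
    exact ih (by simpa [this] using h') h

lemma continuantSeq_im_pos {N : ℕ} (hneg : ∀ j, j + 1 < N → θ j < 0) {z : ℂ} (hz : 0 < z.im)
    {j : ℕ} (hj : j < N) :
    0 < (aeval z (continuantSeq θ (j + 1)) *
      (starRingEnd ℂ) (aeval z (continuantSeq θ j))).im := by
  induction j with
  | zero => simpa [continuantSeq] using hz
  | succ j ih =>
    have h := ih (by omega)
    have hθ := hneg j hj
    rw [continuantSeq_aeval_add_two]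
    simp only [Complex.mul_im, Complex.add_re, Complex.add_im, Complex.conj_re, Complex.conj_im,
      Complex.mul_re, Complex.ofReal_re, Complex.ofReal_im] at h ⊢
    nlinarith [mul_nonneg hz.le (sq_nonneg (aeval z (continuantSeq θ (j + 1))).re),
      mul_nonneg hz.le (sq_nonneg (aeval z (continuantSeq θ (j + 1))).im),
      mul_pos (neg_pos.2 hθ) h]

lemma continuantSeq_wronskian_pos {N : ℕ} (hneg : ∀ j, j + 1 < N → θ j < 0) (x : ℝ)
    {j : ℕ} (hj : j < N) :
    0 < (derivative (continuantSeq θ (j + 1))).eval x * (continuantSeq θ j).eval x -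
      (continuantSeq θ (j + 1)).eval x * (derivative (continuantSeq θ j)).eval x := by
  induction j with
  | zero => simp [continuantSeq]
  | succ j ih =>
    have h := ih (by omega)
    have hθ := hneg j hj
    rw [continuantSeq_eval_add_two, continuantSeq_eval_derivative_add_two]
    nlinarith [sq_nonneg ((continuantSeq θ (j + 1)).eval x), mul_pos (neg_pos.2 hθ) h]

variable {κ : ℕ} (hκ : 1 ≤ κ) (hneg : ∀ j, j + 1 < 2 * κ → θ j < 0)
  (hpos : ∀ j, 2 * κ ≤ j + 1 → 0 < θ j) (m : ℕ)

include hκ hneg hpos in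
lemma continuantSeq_im_neg {z : ℂ} (hz : 0 < z.re) (hz' : 0 < z.im) :
    (aeval z (continuantSeq θ (2 * κ + 2 * m + 1)) *
      (starRingEnd ℂ) (z * aeval z (continuantSeq θ (2 * κ + 2 * m)))).im < 0 := by
  refine coupled_neg hκ (θ := θ) (q := fun j => Complex.normSq (aeval z (continuantSeq θ j)))
    (U := fun j => (aeval z (continuantSeq θ (j + 1)) *
      (starRingEnd ℂ) (z * aeval z (continuantSeq θ j))).im)
    (T := fun j => (z * aeval z (continuantSeq θ (j + 1)) *
      (starRingEnd ℂ) (aeval z (continuantSeq θ j))).im) (s := (z * z).im) ?_ hneg hpos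
    (fun j => Complex.normSq_nonneg _) ?_ ?_ ?_ ?_ ?_ m
  · simp only [Complex.mul_im]; nlinarith [mul_pos hz hz']
  · simp only [continuantSeq, aeval_X]
    exact Complex.normSq_pos.2 fun h => by simp [h] at hz
  · simp [continuantSeq, Complex.mul_im]; ring
  · simp [continuantSeq, Complex.mul_im]; nlinarith [mul_pos hz hz']
  · intro j
    simp only [continuantSeq_aeval_add_two, map_mul, Complex.mul_im, Complex.add_re,
      Complex.add_im, Complex.conj_re, Complex.conj_im, Complex.mul_re, Complex.ofReal_re,
      Complex.ofReal_im]
    ring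
  · intro j
    simp only [continuantSeq_aeval_add_two, map_mul, Complex.mul_im, Complex.add_re,
      Complex.add_im, Complex.conj_re, Complex.conj_im, Complex.mul_re, Complex.ofReal_re,
      Complex.ofReal_im, Complex.normSq_apply]
    ring

include hκ hneg hpos in
lemma continuantSeq_weighted_wronskian_neg {x : ℝ} (hx : 0 < x) :
    x * ((derivative (continuantSeq θ (2 * κ + 2 * m + 1))).eval x *
        (continuantSeq θ (2 * κ + 2 * m)).eval x -
      (continuantSeq θ (2 * κ + 2 * m + 1)).eval x *
        (derivative (continuantSeq θ (2 * κ + 2 * m))).eval x) -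
      (continuantSeq θ (2 * κ + 2 * m + 1)).eval x *
        (continuantSeq θ (2 * κ + 2 * m)).eval x < 0 := by
  refine coupled_neg hκ (θ := θ) (q := fun j => (continuantSeq θ j).eval x ^ 2)
    (U := fun j => x * ((derivative (continuantSeq θ (j + 1))).eval x *
        (continuantSeq θ j).eval x - (continuantSeq θ (j + 1)).eval x *
        (derivative (continuantSeq θ j)).eval x) -
      (continuantSeq θ (j + 1)).eval x * (continuantSeq θ j).eval x)
    (T := fun j => x * ((derivative (continuantSeq θ (j + 1))).eval x *
        (continuantSeq θ j).eval x - (continuantSeq θ (j + 1)).eval x *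
        (derivative (continuantSeq θ j)).eval x) +
      (continuantSeq θ (j + 1)).eval x * (continuantSeq θ j).eval x)
    (s := 2 * x) (by positivity) hneg hpos (fun j => sq_nonneg _) ?_ ?_ ?_ ?_ ?_ m
  · simp only [continuantSeq, eval_X]; positivity
  · simp [continuantSeq]
  · simp [continuantSeq]; positivity
  · intro j
    simp only [continuantSeq_eval_add_two, continuantSeq_eval_derivative_add_two]
    ring
  · intro j
    simp only [continuantSeq_eval_add_two, continuantSeq_eval_derivative_add_two]
    ring

include hneg in
lemma continuantSeq_even_eval_zero_sign {i : ℕ} (hi : i ≤ κ) :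
    0 < (-1) ^ i * (continuantSeq θ (2 * i)).eval 0 := by
  induction i with
  | zero => simp [continuantSeq]
  | succ i ih =>
    have h1 := ih (by omega)
    have h2 := hneg (2 * i) (by omega)
    rw [show 2 * (i + 1) = 2 * i + 2 by ring, continuantSeq_eval_add_two, pow_succ]
    nlinarith [mul_pos (neg_pos.2 h2) h1]

include hneg hpos in
lemma continuantSeq_eval_zero_sign :
    0 < (-1) ^ κ * (continuantSeq θ (2 * κ + 2 * m)).eval 0 := by
  induction m with
  | zero => simpa using continuantSeq_even_eval_zero_sign hneg le_rfl
  | succ m ih =>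
    rw [show 2 * κ + 2 * (m + 1) = 2 * κ + 2 * m + 2 by ring, continuantSeq_eval_add_two]
    nlinarith [mul_pos (hpos (2 * κ + 2 * m) (by omega)) ih]

include hpos in
/-- If the two top terms have opposite signs, so have all neighbours down to index `2 * κ`. -/
lemma continuantSeq_same_sign {x : ℝ} (hx : 0 < x)
    (h : (continuantSeq θ (2 * κ + 2 * m + 1)).eval x *
      (continuantSeq θ (2 * κ + 2 * m)).eval x < 0) :
    0 < (continuantSeq θ (2 * κ + 2 * m)).eval x * (continuantSeq θ (2 * κ)).eval x := by
  have step : ∀ j, 2 * κ ≤ j + 1 →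
      (continuantSeq θ (j + 2)).eval x * (continuantSeq θ (j + 1)).eval x < 0 →
      (continuantSeq θ (j + 1)).eval x * (continuantSeq θ j).eval x < 0 := by
    intro j hj h
    have hθ := hpos j hj
    rw [continuantSeq_eval_add_two] at h
    by_contra! h'
    nlinarith [mul_nonneg hθ.le h', mul_nonneg hx.le (sq_nonneg (eval x (continuantSeq θ (j + 1))))]
  induction m with
  | zero =>
    rcases eq_or_ne ((continuantSeq θ (2 * κ)).eval x) 0 with h0 | h0
    · simp [h0] at h
    · simpa using h0
  | succ m ih =>
    rw [show 2 * κ + 2 * (m + 1) = 2 * κ + 2 * m + 2 by ring] at h ⊢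
    have h1 := step _ (by omega) h
    have h2 := step _ (by omega) h1
    have h3 := ih h2
    have h4 := mul_pos_of_neg_of_neg h1 h2
    have h5 := mul_pos h4 h3
    have h6 : 0 < (eval x (continuantSeq θ (2 * κ + 2 * m + 1)) *
      eval x (continuantSeq θ (2 * κ + 2 * m))) ^ 2 := by
      have := h2.ne; positivity
    by_contra! h7
    nlinarith [mul_nonneg h6.le (neg_nonneg.2 h7)]

include hκ hpos in
lemma continuantSeq_sign_of_eval_eq_zero {x : ℝ} (hx : 0 < x)
    (h : (continuantSeq θ (2 * κ)).eval x = 0)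
    (h' : (continuantSeq θ (2 * κ - 1)).eval x ≠ 0) (i : ℕ) :
    0 ≤ (continuantSeq θ (2 * κ + i)).eval x * (continuantSeq θ (2 * κ - 1)).eval x ∧
    0 < (continuantSeq θ (2 * κ + i + 1)).eval x * (continuantSeq θ (2 * κ - 1)).eval x := by
  induction i with
  | zero =>
    refine ⟨by simp [h], ?_⟩
    obtain ⟨j, hj⟩ : ∃ j, 2 * κ = j + 1 := ⟨2 * κ - 1, by omega⟩
    have h1 := hpos j (by omega)
    rw [hj] at h h' ⊢
    rw [add_zero, continuantSeq_eval_add_two, h]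
    rw [Nat.add_sub_cancel] at h' ⊢
    rw [mul_zero, zero_add, mul_assoc]
    exact mul_pos h1 (mul_self_pos.2 h')
  | succ i ih =>
    refine ⟨ih.2.le, ?_⟩
    have h1 := hpos (2 * κ + i) (by omega)
    rw [show 2 * κ + (i + 1) + 1 = 2 * κ + i + 2 by ring, continuantSeq_eval_add_two]
    nlinarith [mul_pos hx ih.2, mul_nonneg h1.le ih.1]

end ContinuantSeq

section RootCounting

open Classical in
/-- The sign of a monic real polynomial at a point is given by the parity of the number of its
larger roots. -/
lemma eval_mul_neg_one_pow_card_roots_pos {p : ℝ[X]} (hp : p.Monic) {x : ℝ}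
    (hx : p.eval x ≠ 0) :
    0 < p.eval x * (-1) ^ Multiset.card (p.roots.filter fun y => x < y) := by
  obtain ⟨q, hq, -, hq0⟩ := exists_prod_multiset_X_sub_C_mul p
  have hqm : q.Monic := (monic_multisetProd_X_sub_C p.roots).of_mul_monic_left (by rw [hq]; exact hp)
  have hqne : ∀ y, q.eval y ≠ 0 := fun y hy => by
    have : y ∈ q.roots := (mem_roots hqm.ne_zero).2 hy
    simp [hq0] at this
  have hqpos : 0 < q.eval x := by
    by_contra! hle
    have hlt := lt_of_le_of_ne hle (hqne x)
    have hdeg : 0 < q.degree := by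
      by_contra! h
      rw [eq_C_of_degree_le_zero h] at hlt hqm
      have : q.coeff 0 = 1 := by simpa [Monic] using hqm
      simp [this] at hlt
      linarith
    have ht := tendsto_atTop_of_leadingCoeff_nonneg q hdeg (by rw [hqm]; norm_num)
    obtain ⟨y, hy, hxy⟩ := ((ht.eventually_gt_atTop 0).and
      (Filter.eventually_ge_atTop x)).exists
    obtain ⟨t, -, ht⟩ := intermediate_value_Icc hxy q.continuousOn ⟨hle, hy.le⟩
    exact hqne t ht
  have key : ∀ s : Multiset ℝ, x ∉ s →
      0 < ((s.map fun a => X - C a).prod).eval x *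
        (-1) ^ Multiset.card (s.filter fun y => x < y) := by
    intro s
    induction s using Multiset.induction with
    | empty => simp
    | cons a s ih =>
      intro h
      rw [Multiset.mem_cons, not_or] at h
      have := ih h.2
      simp only [Multiset.map_cons, Multiset.prod_cons, eval_mul, eval_sub, eval_X, eval_C]
      rcases lt_or_gt_of_ne h.1 with hlt | hlt
      · rw [Multiset.filter_cons_of_pos _ hlt, Multiset.card_cons, pow_succ]
        nlinarith
      · rw [Multiset.filter_cons_of_neg _ hlt.le.not_gt]
        nlinarith
  have hxr : x ∉ p.roots := fun h => hx ((mem_roots hp.ne_zero).1 h)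
  have h := key p.roots hxr
  have he : p.eval x = ((p.roots.map fun a => X - C a).prod).eval x * q.eval x := by
    rw [← eval_mul, hq]
  rw [he]
  nlinarith

open Classical in
lemma card_roots_filter_lt_eq_add {p : ℝ[X]} {a b : ℝ} (hab : a < b) (hb : p.eval b ≠ 0) :
    Multiset.card (p.roots.filter fun y => a < y) =
      Multiset.card (p.roots.filter fun y => a < y ∧ y < b) +
        Multiset.card (p.roots.filter fun y => b < y) := by
  rw [← Multiset.card_add, Multiset.filter_add_filter]
  have h2 : p.roots.filter (fun y => (a < y ∧ y < b) ∧ b < y) = 0 := by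
    rw [Multiset.filter_eq_nil]
    rintro y - ⟨⟨-, h⟩, h'⟩
    exact lt_asymm h h'
  rw [h2, add_zero]
  congr 1
  refine Multiset.filter_congr fun y hy => ⟨fun h => ?_, ?_⟩
  · rcases lt_trichotomy y b with h' | rfl | h'
    · exact Or.inl ⟨h, h'⟩
    · exact absurd (isRoot_of_mem_roots hy) hb
    · exact Or.inr h'
  · rintro (h | h)
    · exact h.1
    · exact hab.trans h

open Classical in
lemma eval_mul_eval_mul_neg_one_pow_pos {p : ℝ[X]} (hp : p.Monic) {a b : ℝ} (hab : a < b)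
    (ha : p.eval a ≠ 0) (hb : p.eval b ≠ 0) :
    0 < p.eval a * p.eval b *
      (-1) ^ Multiset.card (p.roots.filter fun y => a < y ∧ y < b) := by
  have h1 := eval_mul_neg_one_pow_card_roots_pos hp ha
  have h2 := eval_mul_neg_one_pow_card_roots_pos hp hb
  rw [card_roots_filter_lt_eq_add hab hb, pow_add] at h1
  set u : ℝ := (-1) ^ Multiset.card (p.roots.filter fun y => b < y) with hu
  have hu2 : u * u = 1 := by rw [hu, ← mul_pow]; norm_num
  have h3 := mul_pos h1 h2
  set v : ℝ := (-1) ^ Multiset.card (p.roots.filter fun y => a < y ∧ y < b)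
  rwa [show p.eval a * (v * u) * (p.eval b * u) = p.eval a * p.eval b * v * (u * u) by ring,
    hu2, mul_one] at h3

open Classical in
lemma even_card_roots_of_eval_mul_pos {p : ℝ[X]} (hp : p.Monic) {a b : ℝ} (hab : a < b)
    (h : 0 < p.eval a * p.eval b) :
    Even (Multiset.card (p.roots.filter fun y => a < y ∧ y < b)) := by
  have := eval_mul_eval_mul_neg_one_pow_pos hp hab (left_ne_zero_of_mul h.ne')
    (right_ne_zero_of_mul h.ne')
  by_contra ho
  rw [(Nat.not_even_iff_odd.1 ho).neg_one_pow] at this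
  linarith

open Classical in
lemma odd_card_roots_of_eval_mul_neg {p : ℝ[X]} (hp : p.Monic) {a b : ℝ} (hab : a < b)
    (h : p.eval a * p.eval b < 0) :
    Odd (Multiset.card (p.roots.filter fun y => a < y ∧ y < b)) := by
  have := eval_mul_eval_mul_neg_one_pow_pos hp hab (left_ne_zero_of_mul h.ne)
    (right_ne_zero_of_mul h.ne)
  by_contra ho
  rw [(Nat.not_odd_iff_even.1 ho).neg_one_pow] at this
  linarith

lemma eval_mul_eval_pos_of_no_root {p : ℝ[X]} {a b : ℝ} (hab : a ≤ b)
    (h : ∀ t ∈ Set.Icc a b, p.eval t ≠ 0) : 0 < p.eval a * p.eval b := by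
  by_contra! hle
  have ha := h a ⟨le_rfl, hab⟩
  rcases lt_or_gt_of_ne ha with h' | h'
  · obtain ⟨t, ht, h0⟩ := intermediate_value_Icc hab p.continuousOn
      ⟨h'.le, by by_contra! h2; nlinarith⟩
    exact h t ht h0
  · obtain ⟨t, ht, h0⟩ := intermediate_value_Icc' hab p.continuousOn
      ⟨by by_contra! h2; nlinarith, h'.le⟩
    exact h t ht h0

lemma derivative_eval_of_mul {p q : ℝ[X]} {x : ℝ} (h : p = (X - C x) * q) (y : ℝ) :
    (derivative p).eval y = q.eval y + (y - x) * (derivative q).eval y := by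
  simp [h]

/-- At the first root to the right of `x`, a simple root, `p` crosses zero coming from its sign
at `x`. -/
lemma eval_mul_derivative_neg {p : ℝ[X]} {x y : ℝ} (hxy : x < y) (hx : p.eval x ≠ 0)
    (hy : p.eval y = 0) (hy' : (derivative p).eval y ≠ 0)
    (h : ∀ t ∈ Set.Ioo x y, p.eval t ≠ 0) : p.eval x * (derivative p).eval y < 0 := by
  obtain ⟨q, hq⟩ := dvd_iff_isRoot.2 hy
  have hd : (derivative p).eval y = q.eval y := by simp [derivative_eval_of_mul hq]
  have hpq : ∀ t, p.eval t = (t - y) * q.eval t := fun t => by rw [hq]; simp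
  have := eval_mul_eval_pos_of_no_root (p := q) hxy.le fun t ht h0 => by
    rcases eq_or_lt_of_le ht.2 with rfl | hlt
    · exact hy' (hd.trans h0)
    · rcases eq_or_lt_of_le ht.1 with rfl | hlt'
      · exact hx (by rw [hpq, h0, mul_zero])
      · exact h t ⟨hlt', hlt⟩ (by rw [hpq, h0, mul_zero])
  rw [hd, hpq]
  nlinarith

lemma derivative_mul_derivative_neg {p : ℝ[X]} {x y : ℝ} (hxy : x < y) (hx : p.eval x = 0)
    (hx' : (derivative p).eval x ≠ 0) (hy : p.eval y = 0) (hy' : (derivative p).eval y ≠ 0)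
    (h : ∀ t ∈ Set.Ioo x y, p.eval t ≠ 0) :
    (derivative p).eval x * (derivative p).eval y < 0 := by
  obtain ⟨q, hq⟩ := dvd_iff_isRoot.2 hx
  have hpq : ∀ t, p.eval t = (t - x) * q.eval t := fun t => by rw [hq]; simp
  have hqy : q.eval y = 0 := by
    have := hpq y
    rw [hy, zero_eq_mul] at this
    exact this.resolve_left (by linarith)
  have hdx : (derivative p).eval x = q.eval x := by simp [derivative_eval_of_mul hq]
  have hdy := derivative_eval_of_mul hq y
  rw [hqy, zero_add] at hdy
  have := eval_mul_derivative_neg hxy (p := q) (hdx ▸ hx') hqy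
    (fun h0 => hy' (by rw [hdy, h0, mul_zero]))
    (fun t ht h0 => h t ht (by rw [hpq, h0, mul_zero]))
  rw [hdx, hdy]
  nlinarith

lemma derivative_pos_of_last_root {p : ℝ[X]} (hp : p.Monic) {x : ℝ} (hx : p.eval x = 0)
    (hx' : (derivative p).eval x ≠ 0) (h : ∀ t, x < t → p.eval t ≠ 0) :
    0 < (derivative p).eval x := by
  classical
  obtain ⟨q, hq⟩ := dvd_iff_isRoot.2 hx
  have hpq : ∀ t, p.eval t = (t - x) * q.eval t := fun t => by rw [hq]; simp
  have hdx : (derivative p).eval x = q.eval x := by simp [derivative_eval_of_mul hq]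
  have hqm : q.Monic := (monic_X_sub_C x).of_mul_monic_left (hq ▸ hp)
  have h0 : q.roots.filter (fun y => x < y) = 0 := by
    rw [Multiset.filter_eq_nil]
    intro y hy hxy
    exact h y hxy (by rw [hpq, isRoot_of_mem_roots hy, mul_zero])
  have := eval_mul_neg_one_pow_card_roots_pos hqm (hdx ▸ hx')
  rw [h0] at this
  rw [hdx]
  simpa using this

/-- The positive roots of a real polynomial. -/
noncomputable def posRoots (p : ℝ[X]) : Finset ℝ := {x ∈ p.roots.toFinset | 0 < x}

lemma mem_posRoots {p : ℝ[X]} (hp : p ≠ 0) {x : ℝ} :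
    x ∈ posRoots p ↔ p.eval x = 0 ∧ 0 < x := by
  simp [posRoots, hp]

lemma card_posRoots_le_of_alternating {f g : ℝ[X]} (hf : f ≠ 0) (hg : g ≠ 0)
    (h : ∀ x ∈ posRoots f, 0 < (derivative f).eval x * g.eval x) :
    (posRoots f).card ≤ (posRoots g).card + 1 := by
  refine Finset.card_le_of_interleaved fun x hx y hy hxy hno => ?_
  have h1 := h x hx
  have h2 := h y hy
  obtain ⟨hx0, hxpos⟩ := (mem_posRoots hf).1 hx
  have hy0 := ((mem_posRoots hf).1 hy).1
  have h3 := derivative_mul_derivative_neg hxy hx0 (left_ne_zero_of_mul h1.ne') hy0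
    (left_ne_zero_of_mul h2.ne') fun t ht h0 =>
      hno t ((mem_posRoots hf).2 ⟨h0, hxpos.trans ht.1⟩) ht
  have h4 : g.eval x * g.eval y < 0 := by
    have := mul_pos h1 h2
    by_contra! h5
    nlinarith [mul_nonneg h5 (neg_pos.2 h3).le]
  by_contra! hno'
  have := eval_mul_eval_pos_of_no_root (p := g) hxy.le fun t ht h0 => by
    rcases eq_or_lt_of_le ht.1 with rfl | hlt
    · simp [h0] at h4
    · rcases eq_or_lt_of_le ht.2 with rfl | hlt'
      · simp [h0] at h4
      · exact absurd hlt' (hno' t ((mem_posRoots hg).2 ⟨h0, hxpos.trans hlt⟩) hlt).not_gt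
  linarith

open Classical in
lemma card_filter_roots_eq_card_posRoots {p : ℝ[X]} (hp : p ≠ 0)
    (h : ∀ x ∈ posRoots p, (derivative p).eval x ≠ 0) :
    Multiset.card (p.roots.filter fun y => 0 < y) = (posRoots p).card := by
  have hnd : (p.roots.filter fun y => 0 < y).Nodup := by
    rw [Multiset.nodup_iff_count_le_one]
    intro x
    by_cases hx : 0 < x
    · rw [Multiset.count_filter_of_pos hx, count_roots]
      by_contra! hlt
      obtain ⟨h0, h1⟩ := (one_lt_rootMultiplicity_iff_isRoot hp).1 hlt
      exact h x ((mem_posRoots hp).2 ⟨h0, hx⟩) h1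
    · rw [Multiset.count_filter_of_neg hx]
      exact zero_le_one
  rw [← Multiset.toFinset_card_of_nodup hnd]
  congr 1
  ext x
  simp [posRoots]

lemma eval_zero_mul_neg_one_pow_card_posRoots {p : ℝ[X]} (hp : p.Monic) (h0 : p.eval 0 ≠ 0)
    (h : ∀ x ∈ posRoots p, (derivative p).eval x ≠ 0) :
    0 < p.eval 0 * (-1) ^ (posRoots p).card := by
  classical
  rw [← card_filter_roots_eq_card_posRoots hp.ne_zero h]
  exact eval_mul_neg_one_pow_card_roots_pos hp h0

lemma card_roots_eq_natDegree_of_real {p : ℝ[X]} (hp : p.Monic)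
    (h : ∀ z : ℂ, aeval z p = 0 → z.im = 0) : Multiset.card p.roots = p.natDegree := by
  obtain ⟨q, hq, hd, hq0⟩ := exists_prod_multiset_X_sub_C_mul p
  have hqm : q.Monic := (monic_multisetProd_X_sub_C p.roots).of_mul_monic_left (by rw [hq]; exact hp)
  by_contra hne
  have hdeg : q.degree ≠ 0 := fun h0 => by
    have : q.natDegree = 0 := natDegree_eq_of_degree_eq_some h0
    omega
  obtain ⟨z, hz⟩ := IsAlgClosed.exists_aeval_eq_zero ℂ q hdeg
  have him := h z (by rw [← hq, map_mul, hz, mul_zero])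
  have hzr : z = algebraMap ℝ ℂ z.re := by
    apply Complex.ext <;> simp [him]
  rw [hzr, aeval_algebraMap_apply, map_eq_zero] at hz
  have : z.re ∈ q.roots := (mem_roots hqm.ne_zero).2 (by simpa using hz)
  simp [hq0] at this

end RootCounting

/-- Trailing block, starting at index `s`, of a tridiagonal matrix with diagonal `d`,
superdiagonal `-1` and subdiagonal `e`. -/
def tridiagonalBlock {R : Type*} [CommRing R] (d e : ℕ → R) (s n : ℕ) :
    Matrix (Fin n) (Fin n) R :=
  Matrix.of fun i j : Fin n =>
    if (i : ℕ) = j then d (s + i)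
    else if (i : ℕ) + 1 = j then -1
    else if (i : ℕ) = j + 1 then e (s + j)
    else 0

lemma det_tridiagonalBlock_add_two {R : Type*} [CommRing R] (d e : ℕ → R) (s n : ℕ) :
    (tridiagonalBlock d e s (n + 2)).det =
      d s * (tridiagonalBlock d e (s + 1) (n + 1)).det +
        e s * (tridiagonalBlock d e (s + 2) n).det := by
  rw [det_succ_row_zero, Fin.sum_univ_succ, Fin.sum_univ_succ, Finset.sum_eq_zero]
  · have h1 : (tridiagonalBlock d e s (n + 2)).submatrix Fin.succ (Fin.succAbove 0) =
        tridiagonalBlock d e (s + 1) (n + 1) := by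
      ext i j
      have hi : s + ((i : ℕ) + 1) = s + 1 + i := by omega
      have hj : s + ((j : ℕ) + 1) = s + 1 + j := by omega
      simp [tridiagonalBlock, hi, hj]
    have h2 : ((tridiagonalBlock d e s (n + 2)).submatrix Fin.succ
        (Fin.succAbove (Fin.succ 0))).det = e s * (tridiagonalBlock d e (s + 2) n).det := by
      rw [det_succ_column_zero, Fin.sum_univ_succ, Finset.sum_eq_zero]
      · have h3 : ((tridiagonalBlock d e s (n + 2)).submatrix Fin.succ
            (Fin.succAbove (Fin.succ 0))).submatrix (Fin.succAbove 0) Fin.succ =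
            tridiagonalBlock d e (s + 2) n := by
          ext i j
          have hi : s + ((i : ℕ) + 1 + 1) = s + 2 + i := by omega
          have hj : s + ((j : ℕ) + 1 + 1) = s + 2 + j := by omega
          simp [tridiagonalBlock, hi, hj, -Fin.succ_zero_eq_one]
        rw [h3]
        simp [tridiagonalBlock]
      · intro i _
        simp [tridiagonalBlock]
    rw [h1, h2]
    simp [tridiagonalBlock]
  · intro i _
    simp [tridiagonalBlock]

lemma det_tridiagonalBlock_eq_continuantSeq {e : ℕ → ℝ[X]} {θ : ℕ → ℝ} {d : ℕ → ℝ[X]} {N : ℕ}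
    (he : ∀ j, j + 2 ≤ N → e (N - 2 - j) = C (θ j)) (hd : ∀ s, 1 ≤ s → d s = X) (j : ℕ) :
    (j < N → (tridiagonalBlock d e (N - j) j).det = continuantSeq θ j) := by
  induction j using Nat.strong_induction_on with
  | _ j ih =>
    intro hj
    match j with
    | 0 => simp [continuantSeq]
    | 1 => simp [continuantSeq, tridiagonalBlock, hd (N - 1) (by omega)]
    | j + 2 =>
      have h1 := ih (j + 1) (by omega) (by omega)
      have h2 := ih j (by omega) (by omega)
      rw [det_tridiagonalBlock_add_two, continuantSeq_add_two, hd _ (by omega),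
        show N - (j + 2) + 1 = N - (j + 1) by omega, show N - (j + 2) + 2 = N - j by omega, h1, h2,
        show N - (j + 2) = N - 2 - j by omega, he j (by omega)]

lemma charpoly_signedSchwarz {N k : ℕ} (a : ℝ) (c : Fin (N + 2 - 1) → ℝ) {θ : ℕ → ℝ}
    (hθ : ∀ j : Fin (N + 2 - 1), θ (N - j) = if (j : ℕ) < k then c j else -c j) :
    (signedSchwarz (N + 2) a k c).charpoly =
      continuantSeq θ (N + 2) + C a * continuantSeq θ (N + 1) := by
  set d : ℕ → ℝ[X] := fun i => if i = 0 then X + C a else X with hd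
  set e : ℕ → ℝ[X] := fun i => C (θ (N - i)) with he
  have hmat : charmatrix (signedSchwarz (N + 2) a k c) = tridiagonalBlock d e 0 (N + 2) := by
    ext1 i j
    rw [charmatrix_apply]
    by_cases hij : i = j
    · subst hij
      by_cases hi : i = 0
      · simp [signedSchwarz, tridiagonalBlock, hd, hi]
      · simp [signedSchwarz, tridiagonalBlock, hd, hi]
    · have hij' : (i : ℕ) ≠ j := fun h => hij (Fin.ext h)
      have h00 : ¬((i : ℕ) = 0 ∧ (j : ℕ) = 0) := by omega
      rw [diagonal_apply_ne _ hij, zero_sub]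
      simp only [signedSchwarz, tridiagonalBlock, of_apply, if_neg hij', if_neg h00]
      by_cases h1 : (i : ℕ) + 1 = j
      · simp [h1]
      · rw [if_neg h1, if_neg h1]
        by_cases h2 : (i : ℕ) = j + 1
        · have := hθ ⟨j, by omega⟩
          simp only at this
          rw [dif_pos h2, if_pos h2, he, zero_add]
          simp only [this]
          split_ifs <;> simp
        · rw [dif_neg h2, if_neg h2]
          simp
  have h := det_tridiagonalBlock_eq_continuantSeq (N := N + 2) (e := e) (d := d) (θ := θ)
    (fun j hj => by
      have : N - (N + 2 - 2 - j) = j := by omega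
      simp only [he, this])
    (fun s hs => by simp [hd, Nat.one_le_iff_ne_zero.1 hs])
  have h1 := h (N + 1) (by omega)
  have h2 := h N (by omega)
  rw [show N + 2 - (N + 1) = 1 by omega] at h1
  rw [show N + 2 - N = 2 by omega] at h2
  rw [charpoly, hmat, det_tridiagonalBlock_add_two, h1, h2, continuantSeq_add_two]
  simp only [hd, he, if_true, Nat.sub_zero]
  ring

lemma genHurwitzI_of_posRoots {n κ : ℕ} {p : ℝ[X]} (hp : p.Monic) (hn : Odd n)
    (hdeg : p.natDegree = n) (hcard : (posRoots p).card = κ) (h0 : p.eval 0 ≠ 0)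
    (hcross : ∀ x ∈ posRoots p, (derivative p).eval x * p.eval (-x) < 0)
    (hright : ∀ z : ℂ, aeval z p = 0 → 0 ≤ z.re → z.im = 0) : GenHurwitzI n κ p := by
  classical
  set μ : Fin κ → ℝ := fun i => (posRoots p).orderEmbOfFin hcard i
  have hmono : StrictMono μ := ((posRoots p).orderEmbOfFin hcard).strictMono
  have hmem : ∀ i, μ i ∈ posRoots p := fun i => Finset.orderEmbOfFin_mem _ hcard i
  have hsurj : ∀ x ∈ posRoots p, ∃ i, μ i = x := fun x hx => by
    have : x ∈ Set.range ((posRoots p).orderEmbOfFin hcard) := by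
      rw [Finset.range_orderEmbOfFin]; exact hx
    exact this
  have hroot : ∀ i, p.eval (μ i) = 0 := fun i => ((mem_posRoots hp.ne_zero).1 (hmem i)).1
  have hposμ : ∀ i, 0 < μ i := fun i => ((mem_posRoots hp.ne_zero).1 (hmem i)).2
  have hder : ∀ i, (derivative p).eval (μ i) ≠ 0 := fun i =>
    left_ne_zero_of_mul (hcross _ (hmem i)).ne
  have hne : ∀ i, p.eval (-μ i) ≠ 0 := fun i => right_ne_zero_of_mul (hcross _ (hmem i)).ne
  have hgap : ∀ t, 0 < t → p.eval t = 0 → ∃ i, μ i = t := fun t ht h =>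
    hsurj t ((mem_posRoots hp.ne_zero).2 ⟨h, ht⟩)
  have hcR : ∀ z ∈ cRoots p, aeval z p = 0 := fun z hz => by
    rw [cRoots, mem_roots (hp.map _).ne_zero, IsRoot.def, eval_map_algebraMap] at hz
    exact hz
  refine ⟨μ, hmono, fun i => (hposμ i).le, fun i => ?_, hroot, fun z hz hre => ?_,
    fun z hz him => ?_, fun i _ => hne i, fun i h => ?_, fun h => ?_, fun h => ?_⟩
  · refine le_antisymm ?_ ((rootMultiplicity_pos hp.ne_zero).2 (hroot i))
    by_contra! hlt
    exact hder i ((one_lt_rootMultiplicity_iff_isRoot hp.ne_zero).1 hlt).2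
  · have h := hcR z hz
    have hzr : z = algebraMap ℝ ℂ z.re := by
      apply Complex.ext <;> simp [hright z h hre]
    have hev : p.eval z.re = 0 := by
      rw [hzr, aeval_algebraMap_apply, map_eq_zero] at h
      simpa using h
    have hpos : 0 < z.re := lt_of_le_of_ne hre fun h' => h0 (by rwa [← h'] at hev)
    obtain ⟨i, hi⟩ := hgap _ hpos hev
    exact ⟨i, by rw [hi]; exact hzr⟩
  · by_contra! hre
    exact him (hright z (hcR z hz) hre)
  · set j : Fin κ := ⟨(i : ℕ) + 1, h⟩
    have hij : i < j := Fin.lt_def.2 (Nat.lt_succ_self _)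
    have hd := derivative_mul_derivative_neg (hmono hij) (hroot i) (hder i) (hroot j) (hder j)
      fun t ht h' => by
        obtain ⟨r, rfl⟩ := hgap t ((hposμ i).trans ht.1) h'
        have h1 := Fin.lt_def.1 (hmono.lt_iff_lt.1 ht.1)
        have h2 : (r : ℕ) < i + 1 := Fin.lt_def.1 (hmono.lt_iff_lt.1 ht.2)
        omega
    refine odd_card_roots_of_eval_mul_neg hp (neg_lt_neg (hmono hij)) ?_
    have h3 := mul_pos_of_neg_of_neg (hcross _ (hmem i)) (hcross _ (hmem j))
    by_contra! h4
    nlinarith [mul_nonneg h4 (neg_pos.2 hd).le]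
  · have hd := eval_mul_derivative_neg (hposμ ⟨0, h⟩) h0 (hroot _) (hder _) fun t ht h' => by
        obtain ⟨r, rfl⟩ := hgap t ht.1 h'
        exact Nat.not_lt_zero _ (Fin.lt_def.1 (hmono.lt_iff_lt.1 ht.2))
    refine even_card_roots_of_eval_mul_pos hp (neg_lt_zero.2 (hposμ _)) ?_
    have h3 := mul_pos_of_neg_of_neg (hcross _ (hmem ⟨0, h⟩)) hd
    have h5 := sq_nonneg (eval (μ ⟨0, h⟩) (derivative p))
    by_contra! h4
    nlinarith [mul_nonneg h5 (neg_nonneg.2 h4)]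
  · set i : Fin κ := ⟨κ - 1, Nat.sub_lt h Nat.one_pos⟩ with hi
    have hd := derivative_pos_of_last_root hp (hroot i) (hder i) fun t ht h' => by
      obtain ⟨r, rfl⟩ := hgap t ((hposμ i).trans ht) h'
      have h1 : κ - 1 < (r : ℕ) := Fin.lt_def.1 (hmono.lt_iff_lt.1 ht)
      have := r.isLt
      omega
    have hneg : p.eval (-μ i) < 0 := by
      by_contra! h3
      have := hcross _ (hmem i)
      nlinarith
    have hlead : (p.comp (-X)).leadingCoeff = -1 := by
      rw [leadingCoeff_comp (by simp), hp, hdeg, leadingCoeff_neg, leadingCoeff_X, hn.neg_one_pow,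
        one_mul]
    have hdeg' : 0 < (p.comp (-X)).degree := by
      rw [← natDegree_pos_iff_degree_pos, natDegree_comp, natDegree_neg, natDegree_X, mul_one,
        hdeg]
      exact hn.pos
    have ht := tendsto_atBot_of_leadingCoeff_nonpos _ hdeg' (by rw [hlead]; norm_num)
    have hbig : ∀ᶠ t in Filter.atTop, ∀ y ∈ p.roots.toFinset, -y < t :=
      (Filter.eventually_all_finset _).2 fun y _ => Filter.eventually_gt_atTop (-y)
    obtain ⟨t, ⟨ht1, ht2⟩, ht3⟩ := (((ht.eventually_lt_atBot 0).and hbig).and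
      (Filter.eventually_gt_atTop (μ i))).exists
    have hev : Even (Multiset.card (p.roots.filter fun x => -t < x ∧ x < -μ i)) := by
      refine even_card_roots_of_eval_mul_pos hp (neg_lt_neg ht3) (mul_pos_of_neg_of_neg ?_ hneg)
      simpa using ht1
    have hfilter : (p.roots.filter fun x => -t < x ∧ x < -μ i) =
        p.roots.filter fun x => x < -μ i :=
      Multiset.filter_congr fun y hy => and_iff_right_of_imp fun _ => by
        have := ht2 y (Multiset.mem_toFinset.2 hy)
        linarith
    rw [hfilter] at hev
    exact iff_of_false (Nat.not_even_iff_odd.2 hn) (Nat.not_odd_iff_even.2 hev)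

section Perturbed

variable {θ : ℕ → ℝ} {κ : ℕ} (hκ : 1 ≤ κ) (hneg : ∀ j, j + 1 < 2 * κ → θ j < 0)
  (hpos : ∀ j, 2 * κ ≤ j + 1 → 0 < θ j) (m : ℕ) {a : ℝ} (ha : 0 < a)

include hκ hneg in
lemma continuantSeq_wronskian_top_pos (x : ℝ) :
    0 < (derivative (continuantSeq θ (2 * κ))).eval x * (continuantSeq θ (2 * κ - 1)).eval x -
      (continuantSeq θ (2 * κ)).eval x * (derivative (continuantSeq θ (2 * κ - 1))).eval x := by
  obtain ⟨j, hj⟩ : ∃ j, 2 * κ = j + 1 := ⟨2 * κ - 1, by omega⟩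
  have := continuantSeq_wronskian_pos hneg x (j := j) (by omega)
  rwa [← hj, show j = 2 * κ - 1 by omega] at this

include hneg in
lemma continuantSeq_root_im_eq_zero {z : ℂ} (hz : aeval z (continuantSeq θ (2 * κ)) = 0) :
    z.im = 0 := by
  rcases Nat.eq_zero_or_pos κ with rfl | hκ
  · simp [continuantSeq] at hz
  have key : ∀ w : ℂ, 0 < w.im → aeval w (continuantSeq θ (2 * κ)) ≠ 0 := fun w hw h0 => by
    obtain ⟨j, hj⟩ : ∃ j, 2 * κ = j + 1 := ⟨2 * κ - 1, by omega⟩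
    have := continuantSeq_im_pos hneg hw (j := j) (by omega)
    rw [← hj, h0] at this
    simp at this
  rcases lt_trichotomy z.im 0 with h | h | h
  · refine absurd ?_ (key ((starRingEnd ℂ) z) (by simpa using h))
    rw [aeval_conj, hz, map_zero]
  · exact h
  · exact absurd hz (key z h)

include hκ hneg in
lemma card_posRoots_continuantSeq : (posRoots (continuantSeq θ (2 * κ))).card = κ := by
  classical
  set p := continuantSeq θ (2 * κ) with hp
  have hm : p.Monic := continuantSeq_monic θ _
  have hc : Multiset.card p.roots = 2 * κ :=
    (card_roots_eq_natDegree_of_real hm fun z hz => continuantSeq_root_im_eq_zero hneg hz).trans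
      (continuantSeq_natDegree θ _)
  have hnd : p.roots.Nodup := by
    rw [Multiset.nodup_iff_count_le_one]
    intro x
    rw [count_roots]
    by_contra! hlt
    obtain ⟨h0, h1⟩ := (one_lt_rootMultiplicity_iff_isRoot hm.ne_zero).1 hlt
    rw [IsRoot.def] at h0 h1
    have := continuantSeq_wronskian_top_pos hκ hneg x
    rw [← hp, h0, h1] at this
    simp at this
  have hz : p.eval 0 ≠ 0 :=
    right_ne_zero_of_mul (continuantSeq_even_eval_zero_sign hneg le_rfl).ne'
  have heven : ∀ x, p.eval (-x) = p.eval x := fun x => by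
    rw [hp, continuantSeq_eval_neg, pow_mul]; simp
  have hunion : p.roots.toFinset = posRoots p ∪ (posRoots p).image Neg.neg := by
    ext x
    simp only [Multiset.mem_toFinset, mem_roots hm.ne_zero, IsRoot.def, Finset.mem_union,
      Finset.mem_image, mem_posRoots hm.ne_zero]
    constructor
    · intro hx
      rcases lt_trichotomy x 0 with h | rfl | h
      · exact Or.inr ⟨-x, ⟨by rw [heven, hx], by linarith⟩, neg_neg x⟩
      · exact absurd hx hz
      · exact Or.inl ⟨hx, h⟩
    · rintro (h | ⟨y, h, rfl⟩)
      · exact h.1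
      · rw [heven, h.1]
  have hdisj : Disjoint (posRoots p) ((posRoots p).image Neg.neg) := by
    rw [Finset.disjoint_left]
    intro x hx hx'
    obtain ⟨y, hy, rfl⟩ := Finset.mem_image.1 hx'
    have h1 := ((mem_posRoots hm.ne_zero).1 hx).2
    have h2 := ((mem_posRoots hm.ne_zero).1 hy).2
    linarith
  have h := Multiset.toFinset_card_of_nodup hnd
  rw [hunion, Finset.card_union_of_disjoint hdisj,
    Finset.card_image_of_injective _ neg_injective, hc] at h
  omega

lemma perturbed_monic (N : ℕ) (a : ℝ) :
    (continuantSeq θ (N + 1) + C a * continuantSeq θ N).Monic ∧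
      (continuantSeq θ (N + 1) + C a * continuantSeq θ N).natDegree = N + 1 := by
  have h1 := continuantSeq_natDegree θ (N + 1)
  have hlt : (C a * continuantSeq θ N).natDegree < N + 1 :=
    (natDegree_C_mul_le _ _).trans_lt (by rw [continuantSeq_natDegree]; omega)
  exact ⟨(continuantSeq_monic θ _).add_of_left (degree_lt_degree (by omega)),
    by rw [natDegree_add_eq_left_of_natDegree_lt (by omega), h1]⟩

lemma perturbed_eval_neg (a x : ℝ) :
    (continuantSeq θ (2 * κ + 2 * m + 1) + C a * continuantSeq θ (2 * κ + 2 * m)).eval (-x) =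
      a * (continuantSeq θ (2 * κ + 2 * m)).eval x -
        (continuantSeq θ (2 * κ + 2 * m + 1)).eval x := by
  have h : ((-1 : ℝ)) ^ (2 * κ + 2 * m) = 1 := by rw [← mul_add, pow_mul]; simp
  rw [eval_add, eval_mul, eval_C, continuantSeq_eval_neg, continuantSeq_eval_neg, pow_succ, h]
  ring

include hneg hpos ha in
lemma perturbed_eval_zero :
    0 < (-1) ^ κ * (continuantSeq θ (2 * κ + 2 * m + 1) +
      C a * continuantSeq θ (2 * κ + 2 * m)).eval 0 := by
  have h := continuantSeq_eval_zero_sign hneg hpos m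
  have h1 := continuantSeq_eval_neg θ (2 * κ + 2 * m + 1) 0
  rw [← mul_add, pow_succ, pow_mul, neg_zero] at h1
  have h2 : (continuantSeq θ (2 * (κ + m) + 1)).eval 0 = 0 := by norm_num at h1; linarith
  rw [mul_add] at h2
  rw [eval_add, h2, eval_mul, eval_C, zero_add, mul_left_comm]
  exact mul_pos ha h

include hκ hneg hpos ha in
lemma perturbed_derivative_mul_neg {x : ℝ} (hx : 0 < x)
    (h : (continuantSeq θ (2 * κ + 2 * m + 1) +
      C a * continuantSeq θ (2 * κ + 2 * m)).eval x = 0) :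
    (derivative (continuantSeq θ (2 * κ + 2 * m + 1) +
      C a * continuantSeq θ (2 * κ + 2 * m))).eval x *
        (continuantSeq θ (2 * κ + 2 * m)).eval x < 0 := by
  have hw := continuantSeq_weighted_wronskian_neg hκ hneg hpos m hx
  simp only [eval_add, eval_mul, eval_C] at h
  rw [eq_neg_of_add_eq_zero_left h] at hw
  simp only [derivative_add, derivative_mul, derivative_C, zero_mul, zero_add, eval_add, eval_mul,
    eval_C]
  by_contra! h'
  nlinarith [mul_nonneg hx.le h',
    mul_nonneg ha.le (sq_nonneg (eval x (continuantSeq θ (2 * κ + 2 * m))))]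

include hκ hneg hpos ha in
lemma card_posRoots_perturbed :
    (posRoots (continuantSeq θ (2 * κ + 2 * m + 1) +
      C a * continuantSeq θ (2 * κ + 2 * m))).card = κ := by
  set p := continuantSeq θ (2 * κ + 2 * m + 1) + C a * continuantSeq θ (2 * κ + 2 * m) with hp
  set g := continuantSeq θ (2 * κ) with hg
  have hpm : p.Monic := (perturbed_monic _ a).1
  have hgm : g.Monic := continuantSeq_monic θ _
  have hgc : (posRoots g).card = κ := card_posRoots_continuantSeq hκ hneg
  have hder : ∀ x ∈ posRoots p, (derivative p).eval x *
      (continuantSeq θ (2 * κ + 2 * m)).eval x < 0 := fun x hx => by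
    obtain ⟨h0, hx⟩ := (mem_posRoots hpm.ne_zero).1 hx
    exact perturbed_derivative_mul_neg hκ hneg hpos m ha hx h0
  have hupper : (posRoots p).card ≤ (posRoots (-g)).card + 1 := by
    refine card_posRoots_le_of_alternating hpm.ne_zero (neg_ne_zero.2 hgm.ne_zero) fun x hx => ?_
    have h1 := hder x hx
    obtain ⟨h0, hx⟩ := (mem_posRoots hpm.ne_zero).1 hx
    have hne := right_ne_zero_of_mul h1.ne
    have hE : (continuantSeq θ (2 * κ + 2 * m + 1)).eval x =
        -(a * (continuantSeq θ (2 * κ + 2 * m)).eval x) := by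
      simp only [hp, eval_add, eval_mul, eval_C] at h0
      exact eq_neg_of_add_eq_zero_left h0
    have h2 := continuantSeq_same_sign hpos m hx (by
      have := mul_pos ha (mul_self_pos.2 hne)
      rw [hE]; nlinarith)
    rw [eval_neg]
    by_contra! h3
    have h4 := mul_pos (neg_pos.2 h1) h2
    have h5 := mul_self_pos.2 hne
    nlinarith [mul_nonneg h5.le (neg_nonneg.2 h3)]
  have hlower : (posRoots g).card ≤ (posRoots p).card + 1 := by
    refine card_posRoots_le_of_alternating hgm.ne_zero hpm.ne_zero fun x hx => ?_
    obtain ⟨h0, hx⟩ := (mem_posRoots hgm.ne_zero).1 hx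
    have hw := continuantSeq_wronskian_top_pos hκ hneg x
    rw [← hg, h0, zero_mul, sub_zero] at hw
    obtain ⟨h1, h2⟩ := continuantSeq_sign_of_eval_eq_zero hκ hpos hx h0
      (right_ne_zero_of_mul hw.ne') (2 * m)
    have h3 : 0 < p.eval x * (continuantSeq θ (2 * κ - 1)).eval x := by
      rw [hp, eval_add, eval_mul, eval_C]
      have := mul_nonneg ha.le h1
      nlinarith
    have h4 := mul_pos hw h3
    have h5 := mul_self_pos.2 (right_ne_zero_of_mul hw.ne')
    by_contra! h6
    nlinarith [mul_nonneg h5.le (neg_nonneg.2 h6)]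
  have hng : posRoots (-g) = posRoots g := by simp [posRoots]
  have hs := perturbed_eval_zero hneg hpos m ha
  have hs' := eval_zero_mul_neg_one_pow_card_posRoots hpm
    (right_ne_zero_of_mul hs.ne') fun x hx => left_ne_zero_of_mul (hder x hx).ne
  rw [← hp] at hs
  rw [hng, hgc] at hupper
  rw [hgc] at hlower
  by_contra hne
  have hodd : (-1 : ℝ) ^ (posRoots p).card = -(-1) ^ κ := by
    rcases (by omega : (posRoots p).card = κ + 1 ∨ κ = (posRoots p).card + 1) with h | h
    · rw [h, pow_succ]; ring
    · rw [h, pow_succ]; ring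
  rw [hodd] at hs'
  linarith

include hκ hneg hpos ha in
lemma perturbed_root_im_eq_zero {z : ℂ}
    (hz : aeval z (continuantSeq θ (2 * κ + 2 * m + 1) +
      C a * continuantSeq θ (2 * κ + 2 * m)) = 0) (hre : 0 ≤ z.re) : z.im = 0 := by
  set p := continuantSeq θ (2 * κ + 2 * m + 1) + C a * continuantSeq θ (2 * κ + 2 * m) with hp
  have hsplit : ∀ w : ℂ, aeval w p = 0 → aeval w (continuantSeq θ (2 * κ + 2 * m + 1)) =
      -(a * aeval w (continuantSeq θ (2 * κ + 2 * m))) := fun w hw => by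
    simp only [hp, map_add, map_mul, aeval_C, Complex.coe_algebraMap] at hw
    exact eq_neg_of_add_eq_zero_left hw
  rcases hre.eq_or_lt' with h0 | h0
  · exfalso
    have h1 := hsplit z hz
    have h2 := congrArg (starRingEnd ℂ) h1
    have he : ((-1 : ℂ)) ^ (2 * κ + 2 * m) = 1 := by rw [← mul_add, pow_mul]; simp
    rw [map_neg, map_mul, Complex.conj_ofReal, conj_aeval_continuantSeq_of_re_eq_zero _ _ h0,
      conj_aeval_continuantSeq_of_re_eq_zero _ _ h0, pow_succ, he] at h2
    have h3 : aeval z (continuantSeq θ (2 * κ + 2 * m + 1)) = 0 := by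
      linear_combination (h1 - h2) / 2
    have h4 : aeval z (continuantSeq θ (2 * κ + 2 * m)) = 0 := by
      have : (a : ℂ) ≠ 0 := by exact_mod_cast ha.ne'
      rw [h3, eq_comm, neg_eq_zero, mul_eq_zero] at h1
      exact h1.resolve_left this
    refine continuantSeq_aeval_ne_zero (fun j => ?_) z _ h4 h3
    rcases Nat.lt_or_ge (j + 1) (2 * κ) with h | h
    · exact (hneg j h).ne
    · exact (hpos j h).ne'
  · have key : ∀ w : ℂ, 0 < w.re → 0 < w.im → aeval w p ≠ 0 := fun w h1 h2 hw => by
      have h := continuantSeq_im_neg hκ hneg hpos m h1 h2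
      rw [hsplit w hw] at h
      set v := aeval w (continuantSeq θ (2 * κ + 2 * m))
      have : (-(a * v) * (starRingEnd ℂ) (w * v)).im = a * w.im * (v.re ^ 2 + v.im ^ 2) := by
        simp only [map_mul, Complex.mul_im, Complex.neg_im, Complex.neg_re, Complex.conj_re,
          Complex.conj_im, Complex.mul_re, Complex.ofReal_re, Complex.ofReal_im]
        ring
      rw [this] at h
      have : 0 ≤ a * w.im * (v.re ^ 2 + v.im ^ 2) := by positivity
      linarith
    rcases lt_trichotomy z.im 0 with h | h | h
    · refine absurd ?_ (key ((starRingEnd ℂ) z) (by simpa using h0) (by simpa using h))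
      rw [aeval_conj, hz, map_zero]
    · exact h
    · exact absurd hz (key z h0 h)

include hκ hneg hpos ha in
lemma genHurwitzI_perturbed : GenHurwitzI (2 * κ + 2 * m + 1) κ
    (continuantSeq θ (2 * κ + 2 * m + 1) + C a * continuantSeq θ (2 * κ + 2 * m)) := by
  obtain ⟨hpm, hdeg⟩ := perturbed_monic (θ := θ) (2 * κ + 2 * m) a
  refine genHurwitzI_of_posRoots hpm ⟨κ + m, by ring⟩ hdeg
    (card_posRoots_perturbed hκ hneg hpos m ha)
    (right_ne_zero_of_mul (perturbed_eval_zero hneg hpos m ha).ne') (fun x hx => ?_)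
    fun z hz hre => perturbed_root_im_eq_zero hκ hneg hpos m ha hz hre
  obtain ⟨h0, hx⟩ := (mem_posRoots hpm.ne_zero).1 hx
  have h := perturbed_derivative_mul_neg hκ hneg hpos m ha hx h0
  rw [perturbed_eval_neg]
  simp only [eval_add, eval_mul, eval_C] at h0
  rw [eq_neg_of_add_eq_zero_left h0]
  nlinarith

end Perturbed

/-- for `n = 2l+1` odd and `k = 2m+1` odd, with `a > 0` and all `cᵢ > 0`,
the characteristic polynomial of `S_n` is generalized Hurwitz of type I of order `l-m`. -/
theorem schwarz_stmt15 {l m : ℕ} (a : ℝ) (ha : 0 < a)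
    (c : Fin (2 * l + 1 - 1) → ℝ) (hc : ∀ i, 0 < c i)
    (hk : 2 * m + 1 ≤ 2 * l) :
    GenHurwitzI (2 * l + 1) (l - m)
      (signedSchwarz (2 * l + 1) a (2 * m + 1) c).charpoly := by
  obtain ⟨κ, rfl⟩ : ∃ κ, l = κ + m := ⟨l - m, by omega⟩
  have hκ : 1 ≤ κ := by omega
  rw [Nat.add_sub_cancel]
  obtain ⟨N, hN⟩ : ∃ N, 2 * (κ + m) + 1 = N + 2 := ⟨2 * (κ + m) - 1, by omega⟩
  have hN' : 2 * κ + 2 * m + 1 = N + 2 := by omega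
  have hN'' : 2 * κ + 2 * m = N + 1 := by omega
  generalize 2 * (κ + m) + 1 = n at c hc hN ⊢
  subst hN
  set θ : ℕ → ℝ := fun j => if j ≤ N then
    (if N - j < 2 * m + 1 then c ⟨N - j, by omega⟩ else -c ⟨N - j, by omega⟩) else 1 with hθ
  rw [charpoly_signedSchwarz (θ := θ) a c fun j => by
    have hj : N - (N - (j : ℕ)) = j := by have := j.isLt; omega
    simp only [hθ, hj, if_pos (Nat.sub_le N j)]]
  have h := genHurwitzI_perturbed (θ := θ) hκ (fun j hj => ?_) (fun j hj => ?_) m ha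
  · rwa [hN', hN''] at h
  · have h1 : j ≤ N := by omega
    have h2 : ¬N - j < 2 * m + 1 := by omega
    simp only [hθ, if_pos h1, if_neg h2, neg_lt_zero]
    exact hc _
  · by_cases h1 : j ≤ N
    · have h2 : N - j < 2 * m + 1 := by omega
      simp only [hθ, if_pos h1, if_pos h2]
      exact hc _
    · simp [hθ, h1]
end

section
/- Let p be a real monic polynomial of degree n with p(0) ≠ 0, written p(z) = p_0(z²) + z·p_1(z²). If p is generalized Hurwitz of type I of order κ, then q(z) = p_0(-z²) - z·p_1(-z²) is generalized Hurwitz of type I of order ⌊(n+1)/2⌋ - κ. -/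
open Polynomial Matrix

theorem mul_eval_pos_of_forall_eval_ne_zero {g : ℝ[X]} (hg : ∀ x, g.eval x ≠ 0) (a b : ℝ) :
    0 < g.eval a * g.eval b := by
  refine lt_of_le_of_ne (not_lt.1 fun h => ?_) (mul_ne_zero (hg a) (hg b)).symm
  have h0 : (0 : ℝ) ∈ Set.uIcc (g.eval a) (g.eval b) := by
    rw [Set.mem_uIcc]
    rcases mul_neg_iff.1 h with h | h
    · exact Or.inr ⟨h.2.le, h.1.le⟩
    · exact Or.inl ⟨h.1.le, h.2.le⟩
  obtain ⟨x, -, hx⟩ := intermediate_value_uIcc g.continuous.continuousOn h0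
  exact hg x hx

theorem even_natDegree_of_forall_eval_ne_zero {g : ℝ[X]} (hg : ∀ x, g.eval x ≠ 0) :
    Even g.natDegree := by
  by_contra hodd
  rw [Nat.not_even_iff_odd] at hodd
  have hg0 : g ≠ 0 := fun h => hg 0 (by simp [h])
  have hlead : (g * g.comp (-X)).leadingCoeff ≤ 0 := by
    rw [leadingCoeff_mul, comp_neg_X_leadingCoeff_eq, hodd.neg_one_pow]
    nlinarith [sq_nonneg g.leadingCoeff]
  have hdeg : 0 < (g * g.comp (-X)).degree := by
    rw [degree_mul, degree_comp_neg_X, degree_eq_natDegree hg0]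
    exact_mod_cast Nat.add_pos_left hodd.pos _
  obtain ⟨x, hx⟩ := ((tendsto_atBot_of_leadingCoeff_nonpos _ hdeg hlead).eventually
    (Filter.eventually_lt_atBot 0)).exists
  rw [eval_mul, eval_comp, eval_neg, eval_X] at hx
  exact hx.not_gt (mul_eval_pos_of_forall_eval_ne_zero hg x (-x))

theorem mul_eval_pos_iff_even_card_roots {f : ℝ[X]} {a b : ℝ} (hab : a ≤ b)
    (ha : f.eval a ≠ 0) (hb : f.eval b ≠ 0) :
    0 < f.eval a * f.eval b ↔
      Even (Multiset.card (f.roots.filter fun x => a < x ∧ x < b)) := by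
  obtain ⟨g, hg, -, hg0⟩ := exists_prod_multiset_X_sub_C_mul f
  have hprod : ∀ s : Multiset ℝ, (∀ r ∈ s, r ≠ a ∧ r ≠ b) →
      (s.map fun r => X - C r).prod.eval a * (s.map fun r => X - C r).prod.eval b ≠ 0 ∧
      (0 < (s.map fun r => X - C r).prod.eval a * (s.map fun r => X - C r).prod.eval b ↔
        Even (Multiset.card (s.filter fun x => a < x ∧ x < b))) := by
    intro s
    induction s using Multiset.induction_on with
    | empty => simp
    | cons r s ih =>
      intro hs
      obtain ⟨hne, hiff⟩ := ih fun x hx => hs x (Multiset.mem_cons_of_mem hx)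
      obtain ⟨hra, hrb⟩ := hs r (Multiset.mem_cons_self r s)
      simp only [Multiset.map_cons, Multiset.prod_cons, eval_mul, eval_sub, eval_X, eval_C]
      set u := (s.map fun r => X - C r).prod.eval a
      set v := (s.map fun r => X - C r).prod.eval b
      have key : (a - r) * u * ((b - r) * v) = ((a - r) * (b - r)) * (u * v) := by ring
      rw [key]
      have h1 : (a - r) * (b - r) ≠ 0 :=
        mul_ne_zero (sub_ne_zero.2 hra.symm) (sub_ne_zero.2 hrb.symm)
      refine ⟨mul_ne_zero h1 hne, ?_⟩
      by_cases hr : a < r ∧ r < b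
      · have h2 : (a - r) * (b - r) < 0 :=
          mul_neg_of_neg_of_pos (by linarith [hr.1]) (by linarith [hr.2])
        rw [Multiset.filter_cons_of_pos (p := fun x => a < x ∧ x < b) _ hr, Multiset.card_cons, Nat.even_add_one, ← hiff]
        exact ⟨fun h h' => h.not_gt (mul_neg_of_neg_of_pos h2 h'),
          fun h => mul_pos_of_neg_of_neg h2 (lt_of_le_of_ne (not_lt.1 h) hne)⟩
      · have h2 : 0 < (a - r) * (b - r) := by
          rcases lt_or_gt_of_ne hra with h | h
          · exact mul_pos (by linarith) (by linarith)
          · have h3 : b < r := lt_of_le_of_ne (not_lt.1 fun h' => hr ⟨h, h'⟩) hrb.symm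
            exact mul_pos_of_neg_of_neg (by linarith) (by linarith)
        rw [Multiset.filter_cons_of_neg (p := fun x => a < x ∧ x < b) _ hr, ← hiff, mul_pos_iff_of_pos_left h2]
  have hf0 : f ≠ 0 := fun h => ha (by simp [h])
  obtain ⟨-, h2⟩ := hprod f.roots fun r hr =>
    ⟨fun h => ha (h ▸ (mem_roots hf0).1 hr), fun h => hb (h ▸ (mem_roots hf0).1 hr)⟩
  have hgne : ∀ x, g.eval x ≠ 0 := by
    intro x hx
    have hg00 : g ≠ 0 := fun h => hf0 (by rw [← hg, h, mul_zero])
    have : x ∈ g.roots := (mem_roots hg00).2 hx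
    simp [hg0] at this
  have hgpos := mul_eval_pos_of_forall_eval_ne_zero hgne a b
  rw [← h2]
  conv_rhs => rw [← mul_pos_iff_of_pos_right hgpos, mul_mul_mul_comm, ← eval_mul, ← eval_mul, hg]

theorem even_card_roots_iff_even_natDegree (f : ℝ[X]) :
    Even (Multiset.card f.roots) ↔ Even f.natDegree := by
  obtain ⟨g, -, hg, hg0⟩ := exists_prod_multiset_X_sub_C_mul f
  have : Even g.natDegree := by
    rcases eq_or_ne g 0 with rfl | hg00
    · simp
    · refine even_natDegree_of_forall_eval_ne_zero fun x hx => ?_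
      simpa [hg0] using (mem_roots hg00).2 hx
  rw [← hg, Nat.even_add]
  tauto

theorem Complex.arg_add_arg_neg_conj {w : ℂ} (hw : w.im ≠ 0) :
    w.arg + (-(starRingEnd ℂ w)).arg = if 0 < w.im then Real.pi else -Real.pi := by
  have hpi : w.arg ≠ Real.pi := fun h => hw (Complex.arg_eq_pi_iff.1 h).2
  split_ifs with h
  · rw [Complex.arg_neg_eq_arg_add_pi_of_im_neg (by simpa using h), Complex.arg_conj, if_neg hpi]
    ring
  · rw [Complex.arg_neg_eq_arg_sub_pi_of_im_pos (by
      simpa using lt_of_le_of_ne (not_lt.1 h) hw), Complex.arg_conj, if_neg hpi]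
    ring

theorem cRoots_map_conj (f : ℝ[X]) : (cRoots f).map (starRingEnd ℂ) = cRoots f := by
  unfold cRoots
  rw [← (IsAlgClosed.splits (f.map (algebraMap ℝ ℂ))).roots_map (starRingEnd ℂ), Polynomial.map_map]
  congr 2
  ext x
  simp

theorem card_cRoots_s19 (f : ℝ[X]) : Multiset.card (cRoots f) = f.natDegree := by
  rw [cRoots, IsAlgClosed.card_roots_eq_natDegree, natDegree_map]

theorem exists_phase {f : ℝ[X]} (h : ∀ z ∈ cRoots f, z.re ≠ 0) :
    ∃ φ : ℝ → ℝ, Continuous φ ∧ φ 0 = 0 ∧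
      Filter.Tendsto φ Filter.atTop (nhds (Real.pi / 2 * ((f.natDegree : ℝ) -
        2 * Multiset.card ((cRoots f).filter fun z => 0 < z.re)))) ∧
      ∀ x : ℝ, ∃ ρ : ℝ, 0 < ρ ∧ aeval (x * Complex.I : ℂ) f =
        ((f.eval 0 * ρ * Real.cos (φ x) : ℝ) : ℂ) +
          ((f.eval 0 * ρ * Real.sin (φ x) : ℝ) : ℂ) * Complex.I := by
  have hz0 : ∀ z ∈ cRoots f, z ≠ 0 := fun z hz h0 => h z hz (by simp [h0])
  have him : ∀ z ∈ cRoots f, (-Complex.I / z).im = -z.re / Complex.normSq z := by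
    intro z hz
    simp [Complex.div_im]
  have him0 : ∀ z ∈ cRoots f, (-Complex.I / z).im ≠ 0 := by
    intro z hz
    rw [him z hz]
    exact div_ne_zero (neg_ne_zero.2 (h z hz)) (by simpa using hz0 z hz)
  have hslit : ∀ z ∈ cRoots f, ∀ x : ℝ, 1 + x * (-Complex.I / z) ∈ Complex.slitPlane := by
    intro z hz x
    rw [Complex.mem_slitPlane_iff]
    by_cases hx : x = 0
    · simp [hx]
    · right
      have : (1 + x * (-Complex.I / z)).im = x * (-Complex.I / z).im := by
        simp only [Complex.add_im, Complex.one_im, Complex.im_ofReal_mul,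
          zero_add]
      rw [this]
      exact mul_ne_zero hx (him0 z hz)
  refine ⟨fun x => ((cRoots f).map fun z => (1 + x * (-Complex.I / z)).arg).sum, ?_, ?_, ?_, ?_⟩
  · refine continuous_multiset_sum _ fun z hz => continuous_iff_continuousAt.2 fun x => ?_
    exact (Complex.continuousAt_arg (hslit z hz x)).comp (f := fun x : ℝ => 1 + x * (-Complex.I / z))
      (by fun_prop)
  · simp
  · have hlim : ∀ z ∈ cRoots f, Filter.Tendsto (fun x : ℝ => (1 + x * (-Complex.I / z)).arg)
        Filter.atTop (nhds (-Complex.I / z).arg) := by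
      intro z hz
      have h1 : Filter.Tendsto (fun x : ℝ => ((x⁻¹ : ℝ) : ℂ) + -Complex.I / z) Filter.atTop
          (nhds (((0 : ℝ) : ℂ) + -Complex.I / z)) :=
        ((Complex.continuous_ofReal.tendsto 0).comp tendsto_inv_atTop_zero).add_const _
      rw [Complex.ofReal_zero, zero_add] at h1
      have h2 := (Complex.continuousAt_arg (Complex.mem_slitPlane_iff.2
        (Or.inr (him0 z hz)))).tendsto.comp h1
      refine h2.congr' ?_
      filter_upwards [Filter.eventually_gt_atTop 0] with x hx
      have hxc : (x : ℂ) ≠ 0 := by exact_mod_cast hx.ne'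
      rw [Function.comp_apply, ← Complex.arg_real_mul _ hx]
      congr 1
      push_cast
      field_simp
    convert tendsto_multiset_sum (cRoots f) hlim using 2
    have hconj : ((cRoots f).map fun z => (-Complex.I / z).arg).sum =
        ((cRoots f).map fun z => (-(starRingEnd ℂ (-Complex.I / z))).arg).sum := by
      conv_lhs => rw [← cRoots_map_conj, Multiset.map_map]
      congr 1
      refine Multiset.map_congr rfl fun z hz => ?_
      simp [neg_div]
    have hsum : ((cRoots f).map fun z => (-Complex.I / z).arg).sum +
        ((cRoots f).map fun z => (-(starRingEnd ℂ (-Complex.I / z))).arg).sum =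
        ((cRoots f).map fun z => if 0 < z.re then -Real.pi else Real.pi).sum := by
      rw [← Multiset.sum_map_add]
      congr 1
      refine Multiset.map_congr rfl fun z hz => ?_
      rw [Complex.arg_add_arg_neg_conj (him0 z hz), him z hz]
      have hn : 0 < Complex.normSq z := Complex.normSq_pos.2 (hz0 z hz)
      have hr := h z hz
      by_cases hlt : 0 < z.re
      · rw [if_pos hlt, if_neg (not_lt.2 (div_nonpos_of_nonpos_of_nonneg (by linarith) hn.le))]
      · rw [if_neg hlt, if_pos (div_pos
          (neg_pos.2 (lt_of_le_of_ne (not_lt.1 hlt) hr)) hn)]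
    have hcount : ∀ s : Multiset ℂ,
        (s.map fun z => if 0 < z.re then -Real.pi else Real.pi).sum =
          Real.pi * ((Multiset.card s : ℝ) -
            2 * Multiset.card (s.filter fun z => 0 < z.re)) := by
      intro s
      induction s using Multiset.induction_on with
      | empty => simp
      | cons z s ih =>
        rw [Multiset.map_cons, Multiset.sum_cons, ih]
        by_cases hlt : 0 < z.re
        · rw [if_pos hlt, Multiset.filter_cons_of_pos (p := fun z : ℂ => 0 < z.re) _ hlt]
          push_cast [Multiset.card_cons]
          ring
        · rw [if_neg hlt, Multiset.filter_cons_of_neg (p := fun z : ℂ => 0 < z.re) _ hlt]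
          push_cast [Multiset.card_cons]
          ring
    rw [hcount, ← hconj, card_cRoots_s19] at hsum
    linarith
  · intro x
    have hpoly : ∀ s : Multiset ℂ, (∀ z ∈ s, z ≠ 0) → ∀ w : ℂ,
        (s.map fun z => w - z).prod = (s.map fun z => 0 - z).prod *
          (s.map fun z => 1 - w / z).prod := by
      intro s hs w
      rw [← Multiset.prod_map_mul]
      congr 1
      refine Multiset.map_congr rfl fun z hz => ?_
      have := hs z hz
      field_simp
      ring
    have hexp : ∀ s : Multiset ℂ, (∀ z ∈ s, 1 + x * (-Complex.I / z) ≠ 0) → ∃ ρ : ℝ, 0 < ρ ∧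
        (s.map fun z => 1 + x * (-Complex.I / z)).prod = ρ * Complex.exp
          (((s.map fun z => (1 + x * (-Complex.I / z)).arg).sum : ℝ) * Complex.I) := by
      intro s
      induction s using Multiset.induction_on with
      | empty => exact fun _ => ⟨1, one_pos, by simp⟩
      | cons z s ih =>
        intro hs
        obtain ⟨ρ, hρ, heq⟩ := ih fun y hy => hs y (Multiset.mem_cons_of_mem hy)
        refine ⟨‖1 + x * (-Complex.I / z)‖ * ρ, mul_pos
          (norm_pos_iff.2 (hs z (Multiset.mem_cons_self z s))) hρ, ?_⟩
        rw [Multiset.map_cons, Multiset.prod_cons, heq, Multiset.map_cons, Multiset.sum_cons,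
          Complex.ofReal_add, add_mul _ _ Complex.I, Complex.exp_add]
        conv_lhs => rw [← Complex.norm_mul_exp_arg_mul_I (1 + x * (-Complex.I / z))]
        rw [Complex.ofReal_mul]
        ring
    obtain ⟨ρ, hρ, heq⟩ := hexp (cRoots f) fun z hz => Complex.slitPlane_ne_zero (hslit z hz x)
    refine ⟨ρ, hρ, ?_⟩
    have hs : (f.map (algebraMap ℝ ℂ)).Splits := IsAlgClosed.splits _
    have e0 : ((f.eval 0 : ℝ) : ℂ) = (f.leadingCoeff : ℂ) *
        ((cRoots f).map fun z => 0 - z).prod := by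
      change _ = _ * ((f.aroots ℂ).map fun z => 0 - z).prod
      have := hs.aeval_eq_prod_aroots 0
      rw [← map_zero (algebraMap ℝ ℂ), aeval_algebraMap_apply] at this
      simpa [coe_aeval_eq_eval] using this
    have e1 : aeval (x * Complex.I : ℂ) f = (f.leadingCoeff : ℂ) *
        ((cRoots f).map fun z => x * Complex.I - z).prod := hs.aeval_eq_prod_aroots _
    have e2 : ((cRoots f).map fun z => 1 - x * Complex.I / z).prod =
        ((cRoots f).map fun z => 1 + x * (-Complex.I / z)).prod := by
      congr 1
      refine Multiset.map_congr rfl fun z hz => ?_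
      ring
    rw [e1, hpoly _ hz0, ← mul_assoc, ← e0, e2, heq, Complex.exp_mul_I]
    push_cast
    ring

theorem exists_strictMono_phase_eq {φ : ℝ → ℝ} (hc : Continuous φ) (h0 : φ 0 = 0) {L : ℝ}
    (hL : Filter.Tendsto φ Filter.atTop (nhds L)) (k : ℕ) {t : ℕ → ℝ} (ht : StrictMono t)
    (ht0 : 0 < t 0) (htL : ∀ m < k, t m < L) :
    ∃ ν : Fin k → ℝ, StrictMono ν ∧ ∀ i, 0 < ν i ∧ φ (ν i) = t i := by
  have htpos : ∀ m, 0 < t m := fun m => ht0.trans_le (ht.monotone (Nat.zero_le m))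
  let S : ℝ → Set ℝ := fun u => {x | 0 ≤ x ∧ φ x = u}
  have hbdd : ∀ u, BddBelow (S u) := fun u => ⟨0, fun x hx => hx.1⟩
  have hclosed : ∀ u, IsClosed (S u) := fun u =>
    (isClosed_le continuous_const continuous_id).inter (isClosed_eq hc continuous_const)
  have hivt : ∀ x, 0 ≤ x → ∀ u, 0 ≤ u → u ≤ φ x → ∃ y ≤ x, y ∈ S u := by
    intro x hx u hu hux
    obtain ⟨y, hy, hyu⟩ := intermediate_value_Icc hx hc.continuousOn ⟨h0.le.trans hu, hux⟩
    exact ⟨y, hy.2, hy.1, hyu⟩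
  have hmem : ∀ i : Fin k, sInf (S (t i)) ∈ S (t i) := by
    intro i
    obtain ⟨x, hx, hx0⟩ := ((hL.eventually (lt_mem_nhds (htL i i.2))).and
      (Filter.eventually_ge_atTop 0)).exists
    obtain ⟨y, -, hy⟩ := hivt x hx0 (t i) (htpos i).le hx.le
    exact (hclosed _).csInf_mem ⟨y, hy⟩ (hbdd _)
  refine ⟨fun i => sInf (S (t i)), fun i j hij => ?_, fun i => ⟨?_, (hmem i).2⟩⟩
  · have htij : t i < t j := ht hij
    obtain ⟨y, hyle, hy⟩ := hivt _ (hmem j).1 (t i) (htpos i).le (htij.le.trans (hmem j).2.ge)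
    refine (csInf_le (hbdd _) hy).trans_lt (lt_of_le_of_ne hyle ?_)
    rintro rfl
    exact htij.ne (hy.2.symm.trans (hmem j).2)
  · refine lt_of_le_of_ne (hmem i).1 fun h => ?_
    have := (hmem i).2
    rw [← show 0 = sInf (S (t i)) from h, h0] at this
    exact (htpos i).ne this

theorem mem_Ioo_of_forall_cos_pos {ψ : ℝ → ℝ} (hc : Continuous ψ) {a x : ℝ} (hax : a < x)
    (ha : -(Real.pi / 2) ≤ ψ a) (ha' : ψ a < Real.pi / 2)
    (hcos : ∀ y, a < y → y ≤ x → 0 < Real.cos (ψ y)) :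
    -(Real.pi / 2) < ψ x ∧ ψ x < Real.pi / 2 := by
  have hpi := Real.pi_pos
  constructor
  · by_contra! h
    have h1 : ψ x < -Real.pi := by
      by_contra! h2
      refine (hcos x hax le_rfl).not_ge ?_
      rw [← Real.cos_neg]
      exact Real.cos_nonpos_of_pi_div_two_le_of_le (by linarith) (by linarith)
    obtain ⟨y, hy, hyv⟩ := intermediate_value_Icc' hax.le hc.continuousOn
      (show -Real.pi ∈ Set.Icc (ψ x) (ψ a) from ⟨h1.le, by linarith⟩)
    have hay : a < y := by
      refine lt_of_le_of_ne hy.1 ?_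
      rintro rfl
      linarith
    have := hcos y hay hy.2
    rw [hyv, Real.cos_neg, Real.cos_pi] at this
    linarith
  · by_contra! h
    obtain ⟨y, hy, hyv⟩ := intermediate_value_Icc hax.le hc.continuousOn
      (show Real.pi / 2 ∈ Set.Icc (ψ a) (ψ x) from ⟨ha'.le, h⟩)
    have hay : a < y := by
      refine lt_of_le_of_ne hy.1 ?_
      rintro rfl
      linarith
    have := hcos y hay hy.2
    rw [hyv, Real.cos_pi_div_two] at this
    exact lt_irrefl _ this

theorem le_phase_limit {φ : ℝ → ℝ} (hc : Continuous φ) (h0 : φ 0 = 0) {L : ℝ}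
    (hL : Filter.Tendsto φ Filter.atTop (nhds L)) {κ : ℕ} {μ : Fin κ → ℝ} (hμ : StrictMono μ)
    (hpos : ∀ i, 0 < μ i)
    (hgap : ∀ i ≤ κ, ∀ x, 0 < x → (∀ j : Fin κ, (j : ℕ) < i → μ j < x) →
      (∀ j : Fin κ, i ≤ j → x < μ j) → 0 < Real.cos (φ x + Real.pi / 4 - i * Real.pi))
    (hzero : ∀ i : Fin κ, Real.cos (φ (μ i) + Real.pi / 4 - (i : ℕ) * Real.pi) = 0)
    (hsin : ∀ i : Fin κ, 0 < Real.sin (φ (μ i) + Real.pi / 4 - (i : ℕ) * Real.pi)) :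
    κ * Real.pi - 3 * Real.pi / 4 ≤ L := by
  have hpi := Real.pi_pos
  have hψc : ∀ i : ℕ, Continuous fun x => φ x + Real.pi / 4 - i * Real.pi := fun i => by fun_prop
  have key : ∀ i ≤ κ, ∃ a, 0 ≤ a ∧ (∀ j : Fin κ, (j : ℕ) < i → μ j ≤ a) ∧
      (∀ j : Fin κ, i ≤ j → a < μ j) ∧
      -(Real.pi / 2) ≤ φ a + Real.pi / 4 - i * Real.pi ∧
      φ a + Real.pi / 4 - i * Real.pi < Real.pi / 2 := by
    intro i
    induction i with
    | zero =>
      refine fun _ => ⟨0, le_rfl, by simp, fun j _ => hpos j, ?_, ?_⟩ <;>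
        (rw [h0]; push_cast; linarith)
    | succ i ih =>
      intro hi
      obtain ⟨a, ha0, hlt, hge, hl, hu⟩ := ih (Nat.le_of_succ_le hi)
      set b : Fin κ := ⟨i, hi⟩ with hb
      have hab : a < μ b := hge b le_rfl
      have hin : ∀ x ∈ Set.Ioo a (μ b), φ x + Real.pi / 4 - i * Real.pi ∈
          Set.Icc (-(Real.pi / 2)) (Real.pi / 2) := by
        intro x hx
        have := mem_Ioo_of_forall_cos_pos (hψc i) hx.1 hl hu fun y hay hyx =>
          hgap i (Nat.le_of_succ_le hi) y (ha0.trans_lt hay) (fun j hj => (hlt j hj).trans_lt hay)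
            fun j hj => (hyx.trans_lt hx.2).trans_le (hμ.monotone (Fin.le_def.2 hj))
        exact ⟨this.1.le, this.2.le⟩
      have hbmem : φ (μ b) + Real.pi / 4 - i * Real.pi ∈
          Set.Icc (-(Real.pi / 2)) (Real.pi / 2) := by
        have hcl : μ b ∈ closure (Set.Ioo a (μ b)) := by
          rw [closure_Ioo hab.ne]
          exact ⟨hab.le, le_rfl⟩
        exact isClosed_Icc.closure_subset (map_mem_closure
          (f := fun x => φ x + Real.pi / 4 - i * Real.pi) (hψc i) hcl hin)
      have hb2 : φ (μ b) + Real.pi / 4 - i * Real.pi = Real.pi / 2 := by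
        refine le_antisymm hbmem.2 (not_lt.1 fun h => ?_)
        rcases eq_or_lt_of_le hbmem.1 with h' | h'
        · have := hsin b
          rw [← h', Real.sin_neg, Real.sin_pi_div_two] at this
          linarith
        · exact (Real.cos_pos_of_mem_Ioo ⟨h', h⟩).ne' (hzero b)
      refine ⟨μ b, (hpos b).le, fun j hj => hμ.monotone (Fin.le_def.2 (Nat.le_of_lt_succ hj)),
        fun j hj => hμ (Fin.lt_def.2 hj), ?_, ?_⟩ <;> (push_cast; linarith)
  obtain ⟨a, ha0, hlt, hge, hl, hu⟩ := key κ le_rfl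
  have hfin : ∀ x, a < x → κ * Real.pi - 3 * Real.pi / 4 ≤ φ x := by
    intro x hx
    have := mem_Ioo_of_forall_cos_pos (hψc κ) hx hl hu fun y hay _ =>
      hgap κ le_rfl y (ha0.trans_lt hay) (fun j hj => (hlt j hj).trans_lt hay)
        fun j hj => absurd hj (not_le.2 j.2)
    linarith [this.1]
  exact ge_of_tendsto hL ((Filter.eventually_gt_atTop a).mono hfin)

theorem isRoot_iff_mem_cRoots {f : ℝ[X]} (hf : f ≠ 0) {x : ℝ} :
    f.IsRoot x ↔ (x : ℂ) ∈ cRoots f := by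
  rw [cRoots, mem_roots (map_ne_zero hf), IsRoot.def, IsRoot.def, eval_map_algebraMap,
    show (x : ℂ) = algebraMap ℝ ℂ x from rfl, aeval_algebraMap_apply, coe_aeval_eq_eval]
  simp

theorem count_cRoots (f : ℝ[X]) (x : ℝ) :
    (cRoots f).count (x : ℂ) = f.rootMultiplicity x := by
  rw [cRoots, count_roots, eq_rootMultiplicity_map (algebraMap ℝ ℂ).injective x]
  rfl

theorem card_filter_re_pos_le {f : ℝ[X]} {k : ℕ} {μ : Fin k → ℝ}
    (hmult : ∀ i, f.rootMultiplicity (μ i) = 1)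
    (hroots : ∀ z ∈ cRoots f, 0 ≤ z.re → ∃ i, z = (μ i : ℂ)) :
    Multiset.card ((cRoots f).filter fun z => 0 < z.re) ≤ k := by
  have hnodup : ((cRoots f).filter fun z => 0 < z.re).Nodup := by
    rw [Multiset.nodup_iff_count_le_one]
    intro z
    by_cases hz : z ∈ (cRoots f).filter fun z => 0 < z.re
    · obtain ⟨i, rfl⟩ := hroots z (Multiset.mem_filter.1 hz).1 (Multiset.mem_filter.1 hz).2.le
      refine (Multiset.count_le_of_le _ (Multiset.filter_le _ _)).trans ?_
      rw [count_cRoots, hmult]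
    · rw [Multiset.count_eq_zero_of_notMem hz]
      exact Nat.zero_le _
  have hle : ((cRoots f).filter fun z => 0 < z.re) ≤
      (Finset.univ : Finset (Fin k)).val.map fun i => (μ i : ℂ) := by
    rw [Multiset.le_iff_subset hnodup]
    intro z hz
    obtain ⟨i, rfl⟩ := hroots z (Multiset.mem_filter.1 hz).1 (Multiset.mem_filter.1 hz).2.le
    exact Multiset.mem_map_of_mem _ (Finset.mem_univ i)
  simpa using Multiset.card_le_card hle

theorem filter_re_pos_eq {f : ℝ[X]} (hf : f ≠ 0) {k : ℕ} {μ : Fin k → ℝ} (hμ : StrictMono μ)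
    (hpos : ∀ i, 0 < μ i) (hroot : ∀ i, f.IsRoot (μ i))
    (hcard : Multiset.card ((cRoots f).filter fun z => 0 < z.re) ≤ k) :
    ((cRoots f).filter fun z => 0 < z.re) =
      (Finset.univ : Finset (Fin k)).val.map fun i => (μ i : ℂ) := by
  refine (Multiset.eq_of_le_of_card_le ?_ (by simpa using hcard)).symm
  refine (Multiset.le_iff_subset
    (Finset.univ.nodup.map (Complex.ofReal_injective.comp hμ.injective))).2 fun z hz => ?_
  obtain ⟨i, -, rfl⟩ := Multiset.mem_map.1 hz
  exact Multiset.mem_filter.2 ⟨(isRoot_iff_mem_cRoots hf).1 (hroot i), by simpa using hpos i⟩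

theorem filter_pos_roots_eq {f : ℝ[X]} (hf : f ≠ 0) {k : ℕ} {μ : Fin k → ℝ} (hμ : StrictMono μ)
    (hpos : ∀ i, 0 < μ i) (hmult : ∀ i, f.rootMultiplicity (μ i) = 1)
    (hroot : ∀ i, f.IsRoot (μ i)) (hall : ∀ x, 0 < x → f.IsRoot x → ∃ i, x = μ i) :
    (f.roots.filter fun x => 0 < x) = (Finset.univ : Finset (Fin k)).val.map μ := by
  rw [Multiset.Nodup.ext _ (Finset.univ.nodup.map hμ.injective)]
  · intro x
    rw [Multiset.mem_filter, mem_roots hf, Multiset.mem_map]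
    constructor
    · rintro ⟨hx, hx0⟩
      obtain ⟨i, rfl⟩ := hall x hx0 hx
      exact ⟨i, Finset.mem_univ i, rfl⟩
    · rintro ⟨i, -, rfl⟩
      exact ⟨hroot i, hpos i⟩
  · rw [Multiset.nodup_iff_count_le_one]
    intro x
    by_cases hx : x ∈ f.roots.filter fun x => 0 < x
    · obtain ⟨i, rfl⟩ := hall x (Multiset.mem_filter.1 hx).2
        ((mem_roots hf).1 (Multiset.mem_filter.1 hx).1)
      refine (Multiset.count_le_of_le _ (Multiset.filter_le _ _)).trans ?_
      rw [count_roots, hmult]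
    · rw [Multiset.count_eq_zero_of_notMem hx]
      exact Nat.zero_le _

theorem neg_one_pow_mul_pos {i : ℕ} {a : ℝ} (ha : a ≠ 0) (h : 0 < a ↔ Even i) :
    0 < (-1) ^ i * a := by
  rcases Nat.even_or_odd i with hi | hi
  · rw [hi.neg_one_pow, one_mul]
    exact h.2 hi
  · rw [hi.neg_one_pow, neg_one_mul, neg_pos]
    exact lt_of_le_of_ne (not_lt.1 fun h' => (Nat.not_even_iff_odd.2 hi) (h.1 h')) ha

theorem neg_one_pow_mul_eval_pos {f : ℝ[X]} (h0 : f.eval 0 ≠ 0) {k : ℕ} {μ : Fin k → ℝ}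
    (hfil : (f.roots.filter fun x => 0 < x) = (Finset.univ : Finset (Fin k)).val.map μ)
    {i : ℕ} (hi : i ≤ k) {x : ℝ} (hx : 0 < x) (hlt : ∀ j : Fin k, (j : ℕ) < i → μ j < x)
    (hge : ∀ j : Fin k, i ≤ j → x < μ j) : 0 < (-1) ^ i * (f.eval 0 * f.eval x) := by
  have hf : f ≠ 0 := fun h => h0 (by simp [h])
  have hfx : f.eval x ≠ 0 := by
    intro h
    have : x ∈ f.roots.filter fun x => 0 < x := Multiset.mem_filter.2 ⟨(mem_roots hf).2 h, hx⟩
    rw [hfil] at this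
    obtain ⟨j, -, hj⟩ := Multiset.mem_map.1 this
    rcases lt_or_ge (j : ℕ) i with h' | h'
    · exact (hlt j h').ne hj
    · exact (hge j h').ne' hj
  refine neg_one_pow_mul_pos (mul_ne_zero h0 hfx) ?_
  rw [mul_eval_pos_iff_even_card_roots hx.le h0 hfx]
  have hiff : ∀ j : Fin k, μ j < x ↔ (j : ℕ) < i := fun j =>
    ⟨fun h => not_le.1 fun h' => h.not_gt (hge j h'), hlt j⟩
  have hcard : Multiset.card (f.roots.filter fun y => 0 < y ∧ y < x) = i := by
    simp only [and_comm (a := (0 : ℝ) < _)]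
    rw [← Multiset.filter_filter, hfil, Multiset.filter_map, Multiset.card_map]
    change (Finset.univ.filter fun j => μ j < x).card = i
    simp only [hiff]
    rw [Fin.card_filter_val_lt, min_eq_right hi]
  rw [hcard]

theorem aeval_neg_mul_I (f : ℝ[X]) (x : ℝ) :
    aeval (((-x : ℝ) : ℂ) * Complex.I) f = starRingEnd ℂ (aeval (x * Complex.I : ℂ) f) := by
  rw [← aeval_conj]
  congr 2
  simp

theorem card_eq_card_filter_add {s : Multiset ℝ} {a : ℝ} (ha : 0 < a)
    (hs : ∀ x ∈ s, x ≠ -a ∧ x ≠ 0) :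
    Multiset.card s = Multiset.card (s.filter fun x => x < -a) +
      Multiset.card (s.filter fun x => -a < x ∧ x < 0) +
      Multiset.card (s.filter fun x => 0 < x) := by
  induction s using Multiset.induction_on with
  | empty => simp
  | cons r s ih =>
    have ih := ih fun x hx => hs x (Multiset.mem_cons_of_mem hx)
    obtain ⟨h1, h2⟩ := hs r (Multiset.mem_cons_self r s)
    simp only [Multiset.filter_cons, Multiset.card_add, Multiset.card_cons, ih]
    rcases lt_or_gt_of_ne h1 with h | h
    · have h3 : ¬ -a < r := h.not_gt
      have h4 : ¬ 0 < r := by linarith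
      simp [h, h3, h4]
      ring
    · have h3 : ¬ r < -a := h.not_gt
      rcases lt_or_gt_of_ne h2 with h' | h'
      · simp [h, h3, h', h'.not_gt]
        ring
      · simp [h3, h', h'.not_gt]
        ring

theorem genHurwitzI_of_card_le {n k : ℕ} {f : ℝ[X]} (hdeg : f.natDegree = n)
    (h0 : f.eval 0 ≠ 0) (him : ∀ z ∈ cRoots f, z.re ≠ 0) {ν : Fin k → ℝ} (hν : StrictMono ν)
    (hpos : ∀ i, 0 < ν i) (hroot : ∀ i, f.IsRoot (ν i))
    (hcard : Multiset.card ((cRoots f).filter fun z => 0 < z.re) ≤ k)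
    (hsign : ∀ i : Fin k, 0 < (-1) ^ (i : ℕ) * (f.eval 0 * f.eval (-ν i))) :
    GenHurwitzI n k f := by
  have hf : f ≠ 0 := fun h => h0 (by simp [h])
  have hfil := filter_re_pos_eq hf hν hpos hroot hcard
  have hmult : ∀ i, f.rootMultiplicity (ν i) = 1 := by
    intro i
    refine le_antisymm ?_ ((rootMultiplicity_pos hf).2 (hroot i))
    rw [← count_cRoots, ← Multiset.count_filter_of_pos (p := fun z : ℂ => 0 < z.re)
      (by simpa using hpos i), hfil]
    exact Multiset.nodup_iff_count_le_one.1
      (Finset.univ.nodup.map (Complex.ofReal_injective.comp hν.injective)) _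
  have hright : ∀ z ∈ cRoots f, 0 ≤ z.re → ∃ i, z = (ν i : ℂ) := by
    intro z hz hre
    have : z ∈ (cRoots f).filter fun z => 0 < z.re :=
      Multiset.mem_filter.2 ⟨hz, lt_of_le_of_ne hre (him z hz).symm⟩
    rw [hfil] at this
    obtain ⟨i, -, hi⟩ := Multiset.mem_map.1 this
    exact ⟨i, hi.symm⟩
  have hneg : ∀ i, f.eval (-ν i) ≠ 0 := fun i h => by
    have := hsign i
    simp [h] at this
  refine ⟨ν, hν, fun i => (hpos i).le, hmult, hroot, hright, ?_, fun i _ => hneg i, ?_, ?_, ?_⟩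
  · intro z hz hz'
    by_contra! h
    obtain ⟨i, rfl⟩ := hright z hz h
    exact hz' (Complex.ofReal_im _)
  · intro i h
    rw [← Nat.not_even_iff_odd]
    have hlt : ν i < ν ⟨i + 1, h⟩ := hν (Fin.lt_def.2 (Nat.lt_succ_self _))
    have := mul_eval_pos_iff_even_card_roots (neg_le_neg hlt.le) (hneg ⟨i + 1, h⟩) (hneg i)
    convert mt this.2 (not_lt.2 ?_)
    have h1 := hsign i
    have h2 := hsign ⟨i + 1, h⟩
    have h3 := mul_pos h1 h2
    have h4 : (-1 : ℝ) ^ (i : ℕ) * (-1) ^ (i : ℕ) = 1 := by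
      rw [← mul_pow]; norm_num
    have h5 : (-1) ^ (i : ℕ) * (f.eval 0 * f.eval (-ν i)) *
        ((-1) ^ ((i : ℕ) + 1) * (f.eval 0 * f.eval (-ν ⟨i + 1, h⟩))) =
        -((f.eval 0) ^ 2 * (f.eval (-ν ⟨i + 1, h⟩) * f.eval (-ν i))) := by
      linear_combination (-(f.eval 0) ^ 2 * (f.eval (-ν ⟨i + 1, h⟩) * f.eval (-ν i))) * h4
    rw [h5] at h3
    nlinarith [pow_pos (abs_pos.2 h0) 2, sq_abs (f.eval 0), sq_nonneg (f.eval 0)]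
  · intro h
    have := mul_eval_pos_iff_even_card_roots (neg_nonpos.2 (hpos ⟨0, h⟩).le) (hneg ⟨0, h⟩) h0
    convert this.1 ?_
    have := hsign ⟨0, h⟩
    simpa [mul_comm] using this
  · intro h
    set l : Fin k := ⟨k - 1, Nat.sub_lt h Nat.one_pos⟩ with hl
    have hfilpos := filter_pos_roots_eq hf hν hpos hmult hroot fun x hx hxr => by
      obtain ⟨i, hi⟩ := hright x ((isRoot_iff_mem_cRoots hf).1 hxr) (by simpa using hx.le)
      exact ⟨i, by exact_mod_cast hi⟩
    have hsplit := card_eq_card_filter_add (hpos l) (s := f.roots) fun x hx =>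
      by
        have hx := (mem_roots hf).1 hx
        exact ⟨by rintro rfl; exact hneg l hx, by rintro rfl; exact h0 hx⟩
    have hmid := mul_eval_pos_iff_even_card_roots (neg_nonpos.2 (hpos l).le) (hneg l) h0
    have hpar := even_card_roots_iff_even_natDegree f
    rw [hsplit, hfilpos, hdeg] at hpar
    have hs : 0 < f.eval (-ν l) * f.eval 0 ↔ Even (k - 1) := by
      have h1 := hsign l
      rw [mul_comm (f.eval 0)] at h1
      change 0 < (-1) ^ (k - 1) * _ at h1
      rcases Nat.even_or_odd (k - 1) with hi | hi
      · rw [hi.neg_one_pow, one_mul] at h1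
        exact ⟨fun _ => hi, fun _ => h1⟩
      · rw [hi.neg_one_pow] at h1
        exact ⟨fun h2 => by linarith, fun h2 => absurd hi (Nat.not_odd_iff_even.2 h2)⟩
    rw [hs] at hmid
    have hk : Multiset.card ((Finset.univ : Finset (Fin k)).val.map ν) = k := by simp
    rw [hk] at hpar
    have hkk : Even k ↔ ¬ Even (k - 1) := by
      rw [← Nat.even_add_one, Nat.sub_add_cancel h]
    rw [Nat.even_add, Nat.even_add, ← hmid, hkk] at hpar
    rw [← Nat.not_even_iff_odd]
    tauto

theorem GenHurwitzI.of_dual {n κ : ℕ} {p q : ℝ[X]} (hp : p.natDegree = n) (hq : q.natDegree = n)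
    (h0 : p.eval 0 ≠ 0)
    (hpq : ∀ x : ℝ, q.eval x =
      (aeval (x * Complex.I : ℂ) p).re - (aeval (x * Complex.I : ℂ) p).im)
    (hqp : ∀ x : ℝ, p.eval x =
      (aeval (x * Complex.I : ℂ) q).re - (aeval (x * Complex.I : ℂ) q).im)
    (h : GenHurwitzI n κ p) : GenHurwitzI n ((n + 1) / 2 - κ) q := by
  obtain ⟨μ, hμ, hnonneg, hmult, hroot, hright, -, hneg, hodd, heven, -⟩ := h
  have re_add_mul_I : ∀ a b : ℝ, ((a : ℂ) + b * Complex.I).re = a := by simp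
  have im_add_mul_I : ∀ a b : ℝ, ((a : ℂ) + b * Complex.I).im = b := by simp
  have hpi := Real.pi_pos
  have hqp' : ∀ x : ℝ, p.eval (-x) =
      (aeval (x * Complex.I : ℂ) q).re + (aeval (x * Complex.I : ℂ) q).im := by
    intro x
    rw [hqp, aeval_neg_mul_I, Complex.conj_re, Complex.conj_im, sub_neg_eq_add]
  have hpq' : ∀ x : ℝ, q.eval (-x) =
      (aeval (x * Complex.I : ℂ) p).re + (aeval (x * Complex.I : ℂ) p).im := by
    intro x
    rw [hpq, aeval_neg_mul_I, Complex.conj_re, Complex.conj_im, sub_neg_eq_add]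
  have hp0 : p ≠ 0 := fun h => h0 (by simp [h])
  have hpos : ∀ i, 0 < μ i := fun i => lt_of_le_of_ne (hnonneg i) fun h => h0 (by
    have := hroot i
    rwa [← h] at this)
  have hnegp : ∀ i, p.eval (-μ i) ≠ 0 := fun i => hneg i (Or.inr (hpos i))
  have hall : ∀ x, 0 < x → p.IsRoot x → ∃ i, x = μ i := by
    intro x hx hxr
    obtain ⟨i, hi⟩ := hright x ((isRoot_iff_mem_cRoots hp0).1 hxr) (by simpa using hx.le)
    exact ⟨i, by exact_mod_cast hi⟩
  have himp : ∀ z ∈ cRoots p, z.re ≠ 0 := by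
    intro z hz hre
    obtain ⟨i, rfl⟩ := hright z hz hre.ge
    exact (hpos i).ne' (by simpa using hre)
  have hNp := card_filter_re_pos_le hmult hright
  have hfil := filter_pos_roots_eq hp0 hμ hpos hmult hroot hall
  have hq00 : q.eval 0 = p.eval 0 := by
    have h1 := hqp 0
    simp only [Complex.ofReal_zero, zero_mul] at h1
    rw [← map_zero (algebraMap ℝ ℂ), aeval_algebraMap_apply_eq_algebraMap_eval] at h1
    simpa using h1.symm
  have hq0 : q.eval 0 ≠ 0 := hq00 ▸ h0
  have hqne : q ≠ 0 := fun h => hq0 (by simp [h])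
  have himq : ∀ z ∈ cRoots q, z.re ≠ 0 := by
    intro z hz hre
    have hzI : z = (z.im : ℂ) * Complex.I := by
      apply Complex.ext <;> simp [hre]
    have hz' : aeval ((z.im : ℂ) * Complex.I) q = 0 := by
      rw [← hzI, ← eval_map_algebraMap]
      exact (mem_roots (map_ne_zero hqne)).1 hz
    have h1 : p.eval z.im = 0 := by rw [hqp, hz']; simp
    have h2 : p.eval (-z.im) = 0 := by rw [hqp', hz']; simp
    rcases lt_trichotomy z.im 0 with hlt | heq | hgt
    · obtain ⟨i, hi⟩ := hall (-z.im) (neg_pos.2 hlt) h2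
      exact hnegp i (by rw [← hi, neg_neg, h1])
    · exact h0 (heq ▸ h1)
    · obtain ⟨i, hi⟩ := hall z.im hgt h1
      exact hnegp i (by rw [← hi, h2])
  have hsignp : ∀ (i : ℕ) (hi : i < κ), 0 < (-1) ^ i * (p.eval 0 * p.eval (-μ ⟨i, hi⟩)) := by
    intro i
    induction i with
    | zero =>
      intro hi
      have := mul_eval_pos_iff_even_card_roots (neg_nonpos.2 (hpos ⟨0, hi⟩).le) (hnegp _) h0
      rw [pow_zero, one_mul, mul_comm]
      exact this.2 (by convert heven hi)
    | succ i ih =>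
      intro hi
      have hi' : i < κ := Nat.lt_of_succ_lt hi
      have hlt : μ ⟨i, hi'⟩ < μ ⟨i + 1, hi⟩ := hμ (Fin.lt_def.2 (Nat.lt_succ_self _))
      have := mul_eval_pos_iff_even_card_roots (neg_le_neg hlt.le) (hnegp ⟨i + 1, hi⟩)
        (hnegp ⟨i, hi'⟩)
      have h1 : ¬ 0 < p.eval (-μ ⟨i + 1, hi⟩) * p.eval (-μ ⟨i, hi'⟩) := by
        rw [this, Nat.not_even_iff_odd]
        convert hodd ⟨i, hi'⟩ hi
      have h2 : 0 < -(p.eval (-μ ⟨i + 1, hi⟩) * p.eval (-μ ⟨i, hi'⟩)) :=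
        neg_pos.2 (lt_of_le_of_ne (not_lt.1 h1) (mul_ne_zero (hnegp _) (hnegp _)))
      have h3 := mul_pos h2 (ih hi')
      have h4 : 0 < (p.eval (-μ ⟨i, hi'⟩)) ^ 2 := by
        have := hnegp ⟨i, hi'⟩
        positivity
      refine pos_of_mul_pos_left (b := (p.eval (-μ ⟨i, hi'⟩)) ^ 2) ?_ h4.le
      rw [pow_succ]
      linarith
  have hcs : ∀ (y : ℝ) (i : ℕ), (-1) ^ i * (Real.cos y - Real.sin y) =
      √2 * Real.cos (y + Real.pi / 4 - i * Real.pi) := by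
    intro y i
    rw [Real.cos_sub_nat_mul_pi, Real.cos_add, Real.cos_pi_div_four, Real.sin_pi_div_four]
    have : √2 * √2 = 2 := Real.mul_self_sqrt (by norm_num)
    linear_combination (-(-1) ^ i * (Real.cos y - Real.sin y) / 2) * this
  have hcs' : ∀ (y : ℝ) (i : ℕ), (-1) ^ i * (Real.cos y + Real.sin y) =
      √2 * Real.sin (y + Real.pi / 4 - i * Real.pi) := by
    intro y i
    rw [Real.sin_sub_nat_mul_pi, Real.sin_add, Real.cos_pi_div_four, Real.sin_pi_div_four]
    have : √2 * √2 = 2 := Real.mul_self_sqrt (by norm_num)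
    linear_combination (-(-1) ^ i * (Real.cos y + Real.sin y) / 2) * this
  have h2pos : 0 < √(2 : ℝ) := by positivity
  obtain ⟨θ, hθc, hθ0, hθL, hθ⟩ := exists_phase himq
  set N := Multiset.card ((cRoots q).filter fun z => 0 < z.re) with hN
  have hNq : 2 * N + 2 * κ ≤ n + 1 := by
    have hval : ∀ x, ∃ ρ, 0 < ρ ∧
        p.eval x = p.eval 0 * ρ * (Real.cos (θ x) - Real.sin (θ x)) ∧
        p.eval (-x) = p.eval 0 * ρ * (Real.cos (θ x) + Real.sin (θ x)) := by
      intro x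
      obtain ⟨ρ, hρ, he⟩ := hθ x
      refine ⟨ρ, hρ, ?_, ?_⟩
      · rw [hqp, he, hq00, re_add_mul_I, im_add_mul_I]
        ring
      · rw [hqp', he, hq00, re_add_mul_I, im_add_mul_I]
        ring
    have hfac : ∀ {c ρ s t : ℝ}, c ≠ 0 → 0 < ρ → 0 < s * (c * (c * ρ * t)) → 0 < s * t := by
      intro c ρ s t hc hρ h
      refine pos_of_mul_pos_left (b := c ^ 2 * ρ) ?_ (by positivity)
      linarith
    have hge := le_phase_limit hθc hθ0 hθL hμ hpos (fun i hi x hx hlt hge => ?_) (fun i => ?_)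
      (fun i => ?_)
    · rw [hq] at hge
      have : Real.pi * (2 * κ - 3 / 2) ≤ Real.pi * (n - 2 * N) := by linarith
      have := le_of_mul_le_mul_left this hpi
      have h2 : (2 * N + 2 * κ : ℝ) < (n + 1 : ℕ) + 1 := by push_cast; linarith
      exact Nat.lt_succ_iff.1 (by exact_mod_cast h2)
    · have h1 := neg_one_pow_mul_eval_pos h0 hfil hi hx hlt hge
      obtain ⟨ρ, hρ, he, -⟩ := hval x
      rw [he] at h1
      have h2 := hfac h0 hρ h1
      rw [hcs] at h2
      exact (mul_pos_iff_of_pos_left h2pos).1 h2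
    · obtain ⟨ρ, hρ, he, -⟩ := hval (μ i)
      rw [(hroot i : p.eval (μ i) = 0)] at he
      have h1 : Real.cos (θ (μ i)) - Real.sin (θ (μ i)) = 0 := by
        simpa [h0, hρ.ne'] using he.symm
      have h2 := hcs (θ (μ i)) i
      rw [h1, mul_zero] at h2
      simpa [h2pos.ne'] using h2.symm
    · obtain ⟨ρ, hρ, -, he⟩ := hval (μ i)
      have h1 := hsignp i i.2
      rw [he] at h1
      have h2 := hfac h0 hρ h1
      rw [hcs'] at h2
      exact (mul_pos_iff_of_pos_left h2pos).1 h2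
  obtain ⟨φ, hφc, hφ0, hφL, hφ⟩ := exists_phase himp
  rw [hp] at hφL
  obtain ⟨ν, hν, hνt⟩ := exists_strictMono_phase_eq hφc hφ0 hφL ((n + 1) / 2 - κ)
    (t := fun m => Real.pi / 4 + m * Real.pi) (fun a b hab => by
      have : (a : ℝ) < b := by exact_mod_cast hab
      simpa using mul_lt_mul_of_pos_right this hpi) (by positivity) (fun m hm => by
      have h1 : 2 * m + 1 + 2 * κ ≤ n := by omega
      have h2 : (2 * m + 1 + 2 * κ : ℝ) ≤ n := by exact_mod_cast h1
      have h3 : (Multiset.card ((cRoots p).filter fun z => 0 < z.re) : ℝ) ≤ κ := by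
        exact_mod_cast hNp
      have h4 : Real.pi * (2 * m + 1 / 2) < Real.pi *
          (n - 2 * (Multiset.card ((cRoots p).filter fun z => 0 < z.re) : ℝ)) :=
        mul_lt_mul_of_pos_left (by linarith) hpi
      linarith)
  refine genHurwitzI_of_card_le hq hq0 himq hν (fun i => (hνt i).1) (fun i => ?_) (by omega)
    (fun i => ?_)
  · obtain ⟨ρ, hρ, he⟩ := hφ (ν i)
    rw [IsRoot.def, hpq, he, (hνt i).2]
    have h1 := hcs (Real.pi / 4 + (i : ℕ) * Real.pi) i
    rw [show Real.pi / 4 + (i : ℕ) * Real.pi + Real.pi / 4 - (i : ℕ) * Real.pi = Real.pi / 2 by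
      ring, Real.cos_pi_div_two, mul_zero] at h1
    have h2 := (mul_eq_zero.1 h1).resolve_left (by simp)
    rw [re_add_mul_I, im_add_mul_I]
    linear_combination p.eval 0 * ρ * h2
  · obtain ⟨ρ, hρ, he⟩ := hφ (ν i)
    have h1 := hcs' (Real.pi / 4 + (i : ℕ) * Real.pi) i
    rw [show Real.pi / 4 + (i : ℕ) * Real.pi + Real.pi / 4 - (i : ℕ) * Real.pi = Real.pi / 2 by
      ring, Real.sin_pi_div_two, mul_one] at h1
    have h2 : q.eval (-ν i) = p.eval 0 * ρ * (Real.cos (Real.pi / 4 + (i : ℕ) * Real.pi) +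
        Real.sin (Real.pi / 4 + (i : ℕ) * Real.pi)) := by
      rw [hpq', he, (hνt i).2, re_add_mul_I, im_add_mul_I]
      ring
    have h3 : (-1) ^ (i : ℕ) * (q.eval 0 * q.eval (-ν i)) = p.eval 0 ^ 2 * ρ * √2 := by
      rw [hq00, h2]
      linear_combination p.eval 0 ^ 2 * ρ * h1
    rw [h3]
    positivity

theorem eval_comp_neg_sq_sub (a b : ℝ[X]) (x : ℝ) :
    (a.comp (-(X ^ 2)) - X * b.comp (-(X ^ 2))).eval x =
      (aeval (x * Complex.I : ℂ) (a.comp (X ^ 2) + X * b.comp (X ^ 2))).re -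
        (aeval (x * Complex.I : ℂ) (a.comp (X ^ 2) + X * b.comp (X ^ 2))).im := by
  have hsq : ((x : ℂ) * Complex.I) ^ 2 = algebraMap ℝ ℂ (-(x ^ 2)) := by
    rw [mul_pow, Complex.I_sq]
    simp
  simp only [map_add, map_mul, aeval_comp, map_pow, aeval_X, hsq,
    aeval_algebraMap_apply_eq_algebraMap_eval]
  simp [eval_comp]

theorem eval_comp_sq_add (a b : ℝ[X]) (x : ℝ) :
    (a.comp (X ^ 2) + X * b.comp (X ^ 2)).eval x =
      (aeval (x * Complex.I : ℂ) (a.comp (-(X ^ 2)) - X * b.comp (-(X ^ 2)))).re -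
        (aeval (x * Complex.I : ℂ) (a.comp (-(X ^ 2)) - X * b.comp (-(X ^ 2)))).im := by
  have hsq : -((x : ℂ) * Complex.I) ^ 2 = algebraMap ℝ ℂ (x ^ 2) := by
    rw [mul_pow, Complex.I_sq]
    simp
  simp only [map_sub, map_mul, aeval_comp, map_pow, map_neg, aeval_X]
  simp only [hsq, aeval_algebraMap_apply_eq_algebraMap_eval]
  simp [eval_comp]

theorem natDegree_comp_neg_sq_sub (a b : ℝ[X]) :
    (a.comp (-(X ^ 2)) - X * b.comp (-(X ^ 2))).natDegree =
      (a.comp (X ^ 2) + X * b.comp (X ^ 2)).natDegree := by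
  have hneg : ∀ f : ℝ[X], f.comp (-(X ^ 2)) = (f.comp (-X)).comp (X ^ 2) := fun f => by
    rw [comp_assoc]
    simp
  have hcoeff : ∀ (f : ℝ[X]) (m : ℕ), (f.comp (-(X ^ 2))).coeff m = 0 ↔
      (f.comp (X ^ 2)).coeff m = 0 := by
    intro f m
    rw [hneg, ← expand_eq_comp_X_pow, ← expand_eq_comp_X_pow, coeff_expand two_pos,
      coeff_expand two_pos]
    split_ifs
    · rw [show (-X : ℝ[X]) = C (-1) * X by simp, comp_C_mul_X_coeff]
      simp
    · rfl
  have hodd : ∀ (f : ℝ[X]) (m : ℕ), Odd m → (f.comp (X ^ 2)).coeff m = 0 := by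
    intro f m hm
    rw [← expand_eq_comp_X_pow, coeff_expand two_pos,
      if_neg (by rwa [← even_iff_two_dvd, Nat.not_even_iff_odd])]
  refine natDegree_eq_natDegree ?_
  unfold degree
  congr 1
  ext m
  rw [mem_support_iff, mem_support_iff, not_iff_not, coeff_sub, coeff_add]
  rcases m with _ | m
  · simpa using hcoeff a 0
  · rw [coeff_X_mul, coeff_X_mul]
    rcases Nat.even_or_odd m with hm | hm
    · have h := hodd a (m + 1) hm.add_one
      rw [(hcoeff a (m + 1)).2 h, h, zero_sub, zero_add, neg_eq_zero]
      exact hcoeff b m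
    · have h := hodd b m hm
      rw [(hcoeff b m).2 h, h, sub_zero, add_zero]
      exact hcoeff a (m + 1)

/-- if `p(z) = p₀(z²) + z·p₁(z²)` is monic of degree `n`, `p(0) ≠ 0`, and `p`
is generalized Hurwitz of type I of order `κ`, then `q(z) = p₀(-z²) - z·p₁(-z²)` is
generalized Hurwitz of type I of order `⌊(n+1)/2⌋ - κ`. -/
theorem schwarz_stmt19 {n : ℕ} (p p0 p1 : Polynomial ℝ) (hm : p.Monic)
    (hdeg : p.natDegree = n) (h0 : p.eval 0 ≠ 0)
    (hp : p = p0.comp (Polynomial.X ^ 2) + Polynomial.X * p1.comp (Polynomial.X ^ 2))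
    (κ : ℕ) (hκ : GenHurwitzI n κ p) :
    GenHurwitzI n ((n + 1) / 2 - κ)
      (p0.comp (-(Polynomial.X ^ 2)) - Polynomial.X * p1.comp (-(Polynomial.X ^ 2))) := by
  refine hκ.of_dual hdeg ?_ h0 ?_ ?_
  · rw [natDegree_comp_neg_sq_sub, ← hp, hdeg]
  · rw [hp]
    exact eval_comp_neg_sq_sub p0 p1
  · rw [hp]
    exact eval_comp_sq_add p0 p1
end
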